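/- arXiv:math/0503111 — 6 statements merged into one kernel-verified Lean document; each statement's English description precedes it below -/
import Mathlib

section
/- Let x = x_{i_1}···x_{i_r} be a product of distinct variable images in R = S/I (i_1 < ··· < i_r) and set F = supp(x) = {i_1,…,i_r}. Then for every a ∈ Z^n the degree-a component (R_x)_a of the localization R_x satisfies dim_K (R_x)_a ≤ 1, and (R_x)_a ≅ K if and only if F ⊇ G_a and for every u ∈ G(I) there exists j ∉ F such that ν_j(u) > a_j ≥ 0. -/
/-!
Formalization of results from "Combinatorial characterizations of generalized
Cohen-Macaulay monomial ideals" (Y. Takayama).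

Setting: `K` a field, `S = K[X_1, …, X_n]` realized as `MvPolynomial (Fin n) K`,
`I ⊆ S` a monomial ideal whose minimal monomial generators have the exponent
vectors in `G : Finset (Fin n →₀ ℕ)`.
-/

set_option maxHeartbeats 1000000
set_option synthInstance.maxHeartbeats 400000

open Finset MvPolynomial

namespace GH

variable (K : Type) [Field K]

/-- exponent vectors of monomials in `n` variables -/
abbrev Expo (n : ℕ) := Fin n →₀ ℕ

/-- the monomial ideal of `S = K[X_1, …, X_n]` generated by the monomials `X^u`, `u ∈ G` -/
noncomputable def monIdeal {n : ℕ} (G : Finset (Expo n)) : Ideal (MvPolynomial (Fin n) K) :=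
  Ideal.span ((fun u => monomial u (1 : K)) '' ↑G)

/-- `G` is a minimal set of (exponent vectors of) monomial generators, i.e.
`{X^u : u ∈ G}` is the minimal set `G(I)` of monomial generators of `monIdeal K G` -/
def MinGens {n : ℕ} (G : Finset (Expo n)) : Prop :=
  (∀ u ∈ G, u ≠ 0) ∧ ∀ u ∈ G, ∀ v ∈ G, u ≤ v → u = v

/-- `ρ_j = max{ν_j(u) : u ∈ G(I)}`, the maximal exponent of `X_j` in the generators -/
def rho {n : ℕ} (G : Finset (Expo n)) (j : Fin n) : ℕ := G.sup fun u => u j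

/-- `G_a = {i : a_i < 0}` for a multidegree `a ∈ ℤⁿ` -/
def negSet {n : ℕ} (a : Fin n → ℤ) : Finset (Fin n) := univ.filter fun i => a i < 0

/-- the condition "for every `u ∈ G(I)` there exists `j ∉ F` with `ν_j(u) > a_j ≥ 0`" -/
def hits {n : ℕ} (G : Finset (Expo n)) (a : Fin n → ℤ) (F : Finset (Fin n)) : Prop :=
  ∀ u ∈ G, ∃ j, j ∉ F ∧ 0 ≤ a j ∧ a j < (u j : ℤ)

/-- abstract simplicial complexes on (a subset of) the vertex set `Fin n`;
the empty face is allowed as a face and the void complex is allowed -/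
structure SComplex (n : ℕ) where
  faces : Set (Finset (Fin n))
  down_closed : ∀ ⦃F⦄, F ∈ faces → ∀ ⦃F'⦄, F' ⊆ F → F' ∈ faces

/-- the simplicial complex
`Δ_a = {F - G_a : F ⊇ G_a and ∀ u ∈ G(I) ∃ j ∉ F, ν_j(u) > a_j ≥ 0}` -/
def deltaA {n : ℕ} (G : Finset (Expo n)) (a : Fin n → ℤ) : SComplex n where
  faces := {σ | Disjoint σ (negSet a) ∧ hits G a (σ ∪ negSet a)}
  down_closed := by
    intro F hF F' hsub
    refine ⟨hF.1.mono_left hsub, fun u hu => ?_⟩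
    obtain ⟨j, hj, h⟩ := hF.2 u hu
    exact ⟨j, fun hm => hj (Finset.union_subset_union hsub (Finset.Subset.refl _) hm), h⟩

/-- the Stanley–Reisner complex `Δ` of `√I`: `F ∈ Δ` iff `∏_{i ∈ F} X_i ∉ √I` -/
noncomputable def srComplex {n : ℕ} (G : Finset (Expo n)) : SComplex n where
  faces := {F | (∏ i ∈ F, (X i : MvPolynomial (Fin n) K)) ∉ (monIdeal K G).radical}
  down_closed := by
    intro F hF F' hsub hmem
    exact hF (by rw [← Finset.prod_sdiff hsub]; exact Ideal.mul_mem_left _ _ hmem)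

open Classical in
/-- the degree `a ∈ ℤⁿ` component `(R_x)_a` of the `ℤⁿ`-graded localization `R_x` of
`R = S/I` at `x = x_{i_1} ⋯ x_{i_r} = ∏_{i ∈ F} x_i` (so `F = supp x`): the `K`-span of
the classes of the homogeneous fractions `σ / xˡ` of multidegree `a`, where `σ` is a
monomial -/
noncomputable def locPiece {n : ℕ} (G : Finset (Expo n)) (F : Finset (Fin n))
    (a : Fin n → ℤ) :
    Submodule K (Localization.Away
      (Ideal.Quotient.mk (monIdeal K G) (∏ i ∈ F, X i))) :=
  Submodule.span K
    { y | ∃ (σ : Fin n →₀ ℕ) (ℓ : ℕ),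
        (∀ i : Fin n, (σ i : ℤ) = a i + if i ∈ F then (ℓ : ℤ) else 0) ∧
        y = Localization.mk
              (Ideal.Quotient.mk (monIdeal K G) (monomial σ (1 : K)))
              (⟨(Ideal.Quotient.mk (monIdeal K G) (∏ i ∈ F, X i)) ^ ℓ, ⟨ℓ, rfl⟩⟩ :
                Submonoid.powers (Ideal.Quotient.mk (monIdeal K G) (∏ i ∈ F, X i))) }

/-- The monomial `∏ i ∈ F, X i` to the power `ℓ`, with its exponent vector made explicit. -/
theorem prod_X_pow_eq_monomial {n : ℕ} (F : Finset (Fin n)) (ℓ : ℕ) :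
    (∏ i ∈ F, (X i : MvPolynomial (Fin n) K)) ^ ℓ =
      monomial (ℓ • ∑ i ∈ F, Finsupp.single i 1) 1 := by
  have h : (∏ i ∈ F, (X i : MvPolynomial (Fin n) K)) =
      monomial (∑ i ∈ F, Finsupp.single i 1) 1 :=
    (monomial_sum_one F fun i => Finsupp.single i 1).symm
  rw [h, monomial_pow, one_pow]

theorem sum_single_one_apply {n : ℕ} (F : Finset (Fin n)) (j : Fin n) :
    (∑ i ∈ F, Finsupp.single i 1 : Fin n →₀ ℕ) j = if j ∈ F then 1 else 0 := by
  simp [Finsupp.finsetSum_apply, Finsupp.single_apply]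

theorem monomial_mem_monIdeal_iff {n : ℕ} (G : Finset (Expo n)) (s : Expo n) :
    monomial s (1 : K) ∈ monIdeal K G ↔ ∃ u ∈ G, u ≤ s := by
  rw [monIdeal, mem_ideal_span_monomial_image]
  simp

/-- Two monomial fractions of the same multidegree coincide in `R_x`. -/
theorem mk_monomial_eq_mk_monomial {n : ℕ} (G : Finset (Expo n)) (F : Finset (Fin n))
    {σ τ : Expo n} {ℓ m : ℕ}
    (h : m • (∑ i ∈ F, Finsupp.single i 1) + σ = ℓ • (∑ i ∈ F, Finsupp.single i 1) + τ) :
    (Localization.mk (Ideal.Quotient.mk (monIdeal K G) (monomial σ (1 : K)))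
      (⟨(Ideal.Quotient.mk (monIdeal K G) (∏ i ∈ F, X i)) ^ ℓ, ⟨ℓ, rfl⟩⟩ :
        Submonoid.powers (Ideal.Quotient.mk (monIdeal K G) (∏ i ∈ F, X i)))) =
    Localization.mk (Ideal.Quotient.mk (monIdeal K G) (monomial τ (1 : K)))
      (⟨(Ideal.Quotient.mk (monIdeal K G) (∏ i ∈ F, X i)) ^ m, ⟨m, rfl⟩⟩ :
        Submonoid.powers (Ideal.Quotient.mk (monIdeal K G) (∏ i ∈ F, X i))) := by
  rw [Localization.mk_eq_mk_iff, Localization.r_iff_exists]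
  refine ⟨1, ?_⟩
  dsimp only
  simp only [← map_pow, ← map_mul, prod_X_pow_eq_monomial, monomial_mul, mul_one, h]

/-- A monomial fraction vanishes in `R_x` iff some power of `x` times its numerator
lies in `I`. -/
theorem mk_monomial_eq_zero_iff {n : ℕ} (G : Finset (Expo n)) (F : Finset (Fin n))
    (σ : Expo n) (ℓ : ℕ) :
    (Localization.mk (Ideal.Quotient.mk (monIdeal K G) (monomial σ (1 : K)))
      (⟨(Ideal.Quotient.mk (monIdeal K G) (∏ i ∈ F, X i)) ^ ℓ, ⟨ℓ, rfl⟩⟩ :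
        Submonoid.powers (Ideal.Quotient.mk (monIdeal K G) (∏ i ∈ F, X i)))) = 0 ↔
    ∃ m : ℕ, ∃ u ∈ G, u ≤ m • (∑ i ∈ F, Finsupp.single i 1) + σ := by
  rw [Localization.mk_eq_mk', IsLocalization.mk'_eq_zero_iff]
  simp only [← monomial_mem_monIdeal_iff K]
  constructor
  · rintro ⟨⟨_, m, rfl⟩, hm⟩
    refine ⟨m, ?_⟩
    dsimp only at hm
    rwa [← map_pow, ← map_mul, prod_X_pow_eq_monomial, monomial_mul, mul_one,
      Ideal.Quotient.eq_zero_iff_mem] at hm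
  · rintro ⟨m, hm⟩
    refine ⟨⟨_, m, rfl⟩, ?_⟩
    dsimp only
    rwa [← map_pow, ← map_mul, prod_X_pow_eq_monomial, monomial_mul, mul_one,
      Ideal.Quotient.eq_zero_iff_mem]

/-- For a fraction of multidegree `a`, divisibility by a generator after multiplying by a
power of `x` is governed by the coordinates outside `F`. -/
theorem exists_le_smul_add_iff_not_hits {n : ℕ} (G : Finset (Expo n)) (F : Finset (Fin n))
    (a : Fin n → ℤ) {σ : Expo n} {ℓ : ℕ}
    (hσ : ∀ i : Fin n, (σ i : ℤ) = a i + if i ∈ F then (ℓ : ℤ) else 0) :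
    (∃ m : ℕ, ∃ u ∈ G, u ≤ m • (∑ i ∈ F, Finsupp.single i 1) + σ) ↔ ¬ hits G a F := by
  simp only [hits, not_forall, not_exists, exists_prop, Finsupp.le_def, Finsupp.add_apply,
    Finsupp.smul_apply, sum_single_one_apply, smul_eq_mul]
  constructor
  · rintro ⟨m, u, hu, h⟩
    refine ⟨u, hu, fun j ⟨hjF, _, hlt⟩ => ?_⟩
    have h1 := h j
    have h2 := hσ j
    simp only [hjF, if_false] at h1 h2
    omega
  · rintro ⟨u, hu, h⟩
    refine ⟨univ.sup fun i => u i, u, hu, fun j => ?_⟩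
    have h2 := hσ j
    by_cases hjF : j ∈ F
    · have h3 : u j ≤ univ.sup fun i => u i := Finset.le_sup (f := fun i => u i) (mem_univ j)
      simp only [hjF, if_true]
      omega
    · have h3 := h j
      simp only [hjF, if_false] at h2 ⊢
      have : ¬ (0 ≤ a j ∧ a j < u j) := fun hh => h3 ⟨hjF, hh⟩
      omega

/-- A monomial fraction of multidegree `a` exists iff `G_a ⊆ F`. -/
theorem exists_fraction_iff_negSet_subset {n : ℕ} (F : Finset (Fin n)) (a : Fin n → ℤ) :
    (∃ (σ : Expo n) (ℓ : ℕ),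
      ∀ i : Fin n, (σ i : ℤ) = a i + if i ∈ F then (ℓ : ℤ) else 0) ↔ negSet a ⊆ F := by
  constructor
  · rintro ⟨σ, ℓ, h⟩ i hi
    by_contra hiF
    have h1 := h i
    simp only [negSet, mem_filter, mem_univ, true_and] at hi
    simp only [hiF, if_false] at h1
    omega
  · intro h
    refine ⟨Finsupp.equivFunOnFinite.symm fun i =>
      (a i + if i ∈ F then ((univ.sup fun j => (a j).natAbs : ℕ) : ℤ) else 0).toNat,
      univ.sup fun j => (a j).natAbs, fun i => ?_⟩
    rw [Finsupp.equivFunOnFinite_symm_apply_apply, Int.toNat_of_nonneg]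
    have h3 : (a i).natAbs ≤ univ.sup fun j => (a j).natAbs :=
      Finset.le_sup (f := fun j => (a j).natAbs) (mem_univ i)
    by_cases hiF : i ∈ F
    · simp only [hiF, if_true]
      omega
    · have : ¬ a i < 0 := fun hi => hiF (h (by simpa [negSet] using hi))
      simp only [hiF, if_false]
      omega

/-- If `G_a ⊄ F`, the degree `a` component of `R_x` is zero. -/
theorem locPiece_eq_bot {n : ℕ} (G : Finset (Expo n)) {F : Finset (Fin n)} {a : Fin n → ℤ}
    (h : ¬ negSet a ⊆ F) : locPiece K G F a = ⊥ := by
  rw [locPiece, Submodule.span_eq_bot]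
  rintro _ ⟨σ, ℓ, hσ, -⟩
  exact absurd ((exists_fraction_iff_negSet_subset F a).1 ⟨σ, ℓ, hσ⟩) h

/-- The degree `a` component of `R_x` is spanned by any single monomial fraction of that
degree. -/
theorem locPiece_eq_span_singleton {n : ℕ} (G : Finset (Expo n)) (F : Finset (Fin n))
    (a : Fin n → ℤ) {σ : Expo n} {ℓ : ℕ}
    (hσ : ∀ i : Fin n, (σ i : ℤ) = a i + if i ∈ F then (ℓ : ℤ) else 0) :
    locPiece K G F a = Submodule.span K
      {Localization.mk (Ideal.Quotient.mk (monIdeal K G) (monomial σ (1 : K)))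
        (⟨(Ideal.Quotient.mk (monIdeal K G) (∏ i ∈ F, X i)) ^ ℓ, ⟨ℓ, rfl⟩⟩ :
          Submonoid.powers (Ideal.Quotient.mk (monIdeal K G) (∏ i ∈ F, X i)))} := by
  rw [locPiece]
  congr 1
  ext y
  rw [Set.mem_singleton_iff]
  constructor
  · rintro ⟨τ, m, hτ, rfl⟩
    refine mk_monomial_eq_mk_monomial K G F (Finsupp.ext fun i => ?_)
    have h1 := hσ i
    have h2 := hτ i
    simp only [Finsupp.add_apply, Finsupp.smul_apply, sum_single_one_apply, smul_eq_mul]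
    by_cases hiF : i ∈ F <;> simp only [hiF, if_true, if_false] at h1 h2 ⊢ <;> omega
  · rintro rfl
    exact ⟨σ, ℓ, hσ, rfl⟩

/-- **Lemma 1.1.** Let `x = x_{i_1} ⋯ x_{i_r}` be a product of distinct
variable images in `R = S/I` and `F = supp(x)`. For every `a ∈ ℤⁿ` the degree `a`
component `(R_x)_a` satisfies `dim_K (R_x)_a ≤ 1`, and `(R_x)_a ≅ K` if and only if
`F ⊇ G_a` and for every `u ∈ G(I)` there exists `j ∉ F` with `ν_j(u) > a_j ≥ 0`. -/
theorem rank_locPiece_le_one_and_iso_iff {n : ℕ} (G : Finset (Expo n))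
    (hG : MinGens G) (F : Finset (Fin n)) (a : Fin n → ℤ) :
    Module.rank K ↥(locPiece K G F a) ≤ 1 ∧
      (Nonempty (↥(locPiece K G F a) ≃ₗ[K] K) ↔ negSet a ⊆ F ∧ hits G a F) := by
  by_cases hF : negSet a ⊆ F
  · obtain ⟨σ, ℓ, hσ⟩ := (exists_fraction_iff_negSet_subset F a).2 hF
    have hzero := (mk_monomial_eq_zero_iff K G F σ ℓ).trans
      (exists_le_smul_add_iff_not_hits G F a hσ)
    rw [locPiece_eq_span_singleton K G F a hσ]
    refine ⟨(rank_span_le _).trans (Cardinal.mk_singleton _).le, fun ⟨e⟩ => ⟨hF, ?_⟩,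
      fun ⟨_, hhits⟩ => ?_⟩
    · by_contra hhits
      rw [hzero.2 hhits, Submodule.span_zero_singleton] at e
      exact not_subsingleton K e.symm.toEquiv.subsingleton
    · exact ⟨(LinearEquiv.toSpanNonzeroSingleton K _ _
        fun h0 => hzero.1 h0 hhits).symm⟩
  · rw [locPiece_eq_bot K G hF]
    refine ⟨by simp, fun ⟨e⟩ => ?_, fun h => absurd h.1 hF⟩
    exact absurd e.symm.toEquiv.subsingleton (not_subsingleton K)

end GH
end

section
/- Let I ⊂ S = K[X_1,…,X_n] be a monomial ideal and a ∈ Z^n. If Δ_a ≠ ∅, then G_a is a face of Δ, the Stanley–Reisner complex of √I; equivalently, G_a does not contain supp(u) for any u ∈ G(I). -/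
/-!
Formalization of results from "Combinatorial characterizations of generalized
Cohen-Macaulay monomial ideals" (Y. Takayama).

Setting: `K` a field, `S = K[X_1, …, X_n]` realized as `MvPolynomial (Fin n) K`,
`I ⊆ S` a monomial ideal whose minimal monomial generators have the exponent
vectors in `G : Finset (Fin n →₀ ℕ)`.
-/

set_option maxHeartbeats 1000000
set_option synthInstance.maxHeartbeats 400000

open Finset MvPolynomial

namespace GH

variable (K : Type) [Field K]

/-- A squarefree monomial whose support contains no `supp(u)`, `u ∈ G`, is not in the radical of
the monomial ideal generated by `G`. -/
theorem mem_srComplex_of_not_support_subset {n : ℕ} {G : Finset (Expo n)} {F : Finset (Fin n)}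
    (hF : ∀ u ∈ G, ¬ u.support ⊆ F) : F ∈ (srComplex K G).faces := by
  rintro ⟨m, hm⟩
  let φ : MvPolynomial (Fin n) K →+* K := eval fun i => if i ∈ F then 1 else 0
  have hle : monIdeal K G ≤ RingHom.ker φ := by
    refine Ideal.span_le.2 ?_
    rintro _ ⟨u, hu, rfl⟩
    obtain ⟨j, hj, hjF⟩ := Finset.not_subset.1 (hF u hu)
    simp only [SetLike.mem_coe, RingHom.mem_ker, φ, eval_monomial, one_mul]
    refine Finset.prod_eq_zero hj ?_
    simp [hjF, Finsupp.mem_support_iff.1 hj]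
  have hzero : φ ((∏ i ∈ F, X i) ^ m) = 0 := RingHom.mem_ker.1 (hle hm)
  have hone : φ (∏ i ∈ F, X i) = 1 := by
    rw [map_prod]
    exact Finset.prod_eq_one fun i hi => by simp [φ, hi]
  simp [hone] at hzero

/-- If `Δ_a ≠ ∅`, then `G_a` is a face of the Stanley–Reisner complex
`Δ` of `√I`; equivalently, `G_a` does not contain `supp(u)` for any `u ∈ G(I)`. -/
theorem negSet_mem_srComplex_of_deltaA_nonempty {n : ℕ} (G : Finset (Expo n))
    (hG : MinGens G) (a : Fin n → ℤ) (h : (deltaA G a).faces.Nonempty) :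
    negSet a ∈ (srComplex K G).faces ∧ ∀ u ∈ G, ¬ u.support ⊆ negSet a := by
  obtain ⟨σ, -, hσ⟩ := h
  have hsupp : ∀ u ∈ G, ¬ u.support ⊆ negSet a := by
    intro u hu hsub
    obtain ⟨j, hj, h0, hlt⟩ := hσ u hu
    have hju : j ∈ u.support := Finsupp.mem_support_iff.2 (by omega)
    exact hj (Finset.mem_union_right σ (hsub hju))
  exact ⟨mem_srComplex_of_not_support_subset K hsupp, hsupp⟩

end GH
end

section
/- Let I ⊂ S = K[X_1,…,X_n] be a generalized Cohen–Macaulay monomial ideal. Then R = S/I is (Σ_{j=1}^n ρ_j − n + 1)-Buchsbaum, i.e., m^k H^i_m(R) = 0 for all i ≠ dim R, where k = Σ_{j=1}^n ρ_j − n + 1. -/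
/-!
Formalization of results from "Combinatorial characterizations of generalized
Cohen-Macaulay monomial ideals" (Y. Takayama).

Setting: `K` a field, `S = K[X_1, …, X_n]` realized as `MvPolynomial (Fin n) K`,
`I ⊆ S` a monomial ideal whose minimal monomial generators have the exponent
vectors in `G : Finset (Fin n →₀ ℕ)`.
-/

set_option maxHeartbeats 1000000
set_option synthInstance.maxHeartbeats 400000

open Finset MvPolynomial

namespace GH

variable (K : Type) [Field K]

/-- the graded maximal ideal `𝔪 = (X_1, …, X_n)` of `S` (also denoted `m`);
local cohomology of `S/I` with respect to the maximal ideal of `S/I` agrees with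
local cohomology over `S` with respect to `𝔪` -/
noncomputable def idealM (n : ℕ) : Ideal (MvPolynomial (Fin n) K) :=
  Ideal.span (Set.range (X : Fin n → MvPolynomial (Fin n) K))

/-- the `i`-th local cohomology module `H^i_𝔪(S/I)`, as an `S`-module -/
noncomputable def locCoh {n : ℕ} (I : Ideal (MvPolynomial (Fin n) K)) (i : ℕ) :
    ModuleCat (MvPolynomial (Fin n) K) :=
  (localCohomology (idealM K n) i).obj
    (ModuleCat.of (MvPolynomial (Fin n) K) (MvPolynomial (Fin n) K ⧸ I))

/-- an ideal `I ⊆ S` is generalized Cohen–Macaulay (FLC) if `H^i_𝔪(S/I)` has finite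
length for every `i ≠ dim S/I` -/
def IsGenCM {n : ℕ} (I : Ideal (MvPolynomial (Fin n) K)) : Prop :=
  ∀ i : ℕ, (i : WithBot (WithTop ℕ)) ≠ ringKrullDim (MvPolynomial (Fin n) K ⧸ I) →
    IsFiniteLength (MvPolynomial (Fin n) K) (locCoh K I i)

end GH

section

open CategoryTheory Limits Opposite

section HomologyDesc

variable {D : Type*} [Category* D] [Abelian D]

namespace HomologicalComplex

variable (K L : HomologicalComplex D (ComplexShape.down ℕ)) (n : ℕ)

/-- The morphism out of the homology of a chain complex induced by a morphism `c : K.X n ⟶ T`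
which vanishes on boundaries. -/
noncomputable def homologyDesc {T : D} (c : K.X n ⟶ T) (hc : K.d (n + 1) n ≫ c = 0) :
    K.homology n ⟶ T :=
  K.homologyι n ≫ K.descOpcycles c (n + 1) (by simp) hc

lemma homologyDesc_surjective {T : D} [Injective T] (y : K.homology n ⟶ T) :
    ∃ c hc, K.homologyDesc n c hc = y := by
  have : Mono (K.homologyι n) := inferInstanceAs (Mono (K.sc n).homologyι)
  let e : K.opcycles n ⟶ T := Injective.factorThru y (K.homologyι n)
  have he : K.d (n + 1) n ≫ K.pOpcycles n ≫ e = 0 := by simp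
  refine ⟨K.pOpcycles n ≫ e, he, ?_⟩
  have : K.descOpcycles (K.pOpcycles n ≫ e) (n + 1) (by simp) he = e := by
    rw [← cancel_epi (K.pOpcycles n)]
    simp
  rw [homologyDesc, this, Injective.comp_factorThru]

lemma homologyDesc_eq_zero {T : D} (c : K.X n ⟶ T) (hc : K.d (n + 1) n ≫ c = 0)
    (m : ℕ) (g : K.X m ⟶ T) (hg : K.d n m ≫ g = c) :
    K.homologyDesc n c hc = 0 := by
  have : K.descOpcycles c (n + 1) (by simp) hc = K.fromOpcycles n m ≫ g := by
    rw [← cancel_epi (K.pOpcycles n)]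
    simpa using hg.symm
  rw [homologyDesc, this, K.homologyι_comp_fromOpcycles_assoc, zero_comp]

variable {K L} in
lemma homologyMap_homologyDesc (φ : K ⟶ L) {T : D} (c : L.X n ⟶ T)
    (hc : L.d (n + 1) n ≫ c = 0) :
    homologyMap φ n ≫ L.homologyDesc n c hc =
      K.homologyDesc n (φ.f n ≫ c) (by rw [← φ.comm_assoc, hc, comp_zero]) := by
  rw [homologyDesc, homologyDesc, homologyι_naturality_assoc]
  congr 1
  rw [← cancel_epi (K.pOpcycles n)]
  simp

lemma homologyDesc_comp {T T' : D} (c : K.X n ⟶ T) (hc : K.d (n + 1) n ≫ c = 0) (g : T ⟶ T') :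
    K.homologyDesc n c hc ≫ g = K.homologyDesc n (c ≫ g) (by rw [reassoc_of% hc, zero_comp]) := by
  rw [homologyDesc, homologyDesc, Category.assoc]
  congr 1
  rw [← cancel_epi (K.pOpcycles n)]
  simp

lemma homologyDesc_sub {T : D} (c c' : K.X n ⟶ T) (hc : K.d (n + 1) n ≫ c = 0)
    (hc' : K.d (n + 1) n ≫ c' = 0) :
    K.homologyDesc n c hc - K.homologyDesc n c' hc' =
      K.homologyDesc n (c - c') (by simp [hc, hc']) := by
  rw [homologyDesc, homologyDesc, homologyDesc, ← Preadditive.comp_sub]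
  congr 1
  rw [← cancel_epi (K.pOpcycles n)]
  simp

end HomologicalComplex

end HomologyDesc

namespace CategoryTheory.ProjectiveResolution

universe v u
variable {C : Type u} [Category.{v} C] [Abelian C] [HasProjectiveResolutions C]
  {D : Type*} [Category* D] [Abelian D]
  {X' X : C}

/-- The morphism out of a left derived functor attached to a morphism
`c : F.obj (P.complex.X n) ⟶ T` which vanishes on boundaries. -/
noncomputable def leftDerivedDesc (P : ProjectiveResolution X) (F : C ⥤ D) [F.Additive] (n : ℕ)
    {T : D} (c : F.obj (P.complex.X n) ⟶ T) (hc : F.map (P.complex.d (n + 1) n) ≫ c = 0) :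
    (F.leftDerived n).obj X ⟶ T :=
  (P.isoLeftDerivedObj F n).hom ≫
    ((F.mapHomologicalComplex _).obj P.complex).homologyDesc n c hc

lemma leftDerivedDesc_surjective (P : ProjectiveResolution X) (F : C ⥤ D) [F.Additive] (n : ℕ)
    {T : D} [Injective T] (y : (F.leftDerived n).obj X ⟶ T) :
    ∃ c hc, P.leftDerivedDesc F n c hc = y := by
  obtain ⟨c, hc, h⟩ := ((F.mapHomologicalComplex _).obj P.complex).homologyDesc_surjective n
    ((P.isoLeftDerivedObj F n).inv ≫ y)
  exact ⟨c, hc, (congrArg ((P.isoLeftDerivedObj F n).hom ≫ ·) h).trans (Iso.hom_inv_id_assoc _ _)⟩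

lemma leftDerivedDesc_eq_zero (P : ProjectiveResolution X) (F : C ⥤ D) [F.Additive] (n : ℕ)
    {T : D} (c : F.obj (P.complex.X n) ⟶ T) (hc : F.map (P.complex.d (n + 1) n) ≫ c = 0)
    (m : ℕ) (g : F.obj (P.complex.X m) ⟶ T) (hg : F.map (P.complex.d n m) ≫ g = c) :
    P.leftDerivedDesc F n c hc = 0 :=
  (congrArg ((P.isoLeftDerivedObj F n).hom ≫ ·)
    (((F.mapHomologicalComplex _).obj P.complex).homologyDesc_eq_zero n c hc m g hg)).trans
    comp_zero

lemma map_leftDerivedDesc {P : ProjectiveResolution X} {P' : ProjectiveResolution X'}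
    {f : X' ⟶ X} (φ : Hom P' P f) (F : C ⥤ D) [F.Additive] (n : ℕ)
    {T : D} (c : F.obj (P.complex.X n) ⟶ T) (hc : F.map (P.complex.d (n + 1) n) ≫ c = 0)
    (hc' : F.map (P'.complex.d (n + 1) n) ≫ F.map (φ.hom.f n) ≫ c = 0) :
    (F.leftDerived n).map f ≫ P.leftDerivedDesc F n c hc =
      P'.leftDerivedDesc F n (F.map (φ.hom.f n) ≫ c) hc' :=
  (isoLeftDerivedObj_hom_naturality_assoc f P' P φ.hom
    (φ.hom_f_zero_comp_π_f_zero.trans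
      (congrArg (P'.π.f 0 ≫ ·) (ChainComplex.single₀_map_f_zero f))) F n _).trans
    (congrArg ((P'.isoLeftDerivedObj F n).hom ≫ ·)
      (HomologicalComplex.homologyMap_homologyDesc n
        ((F.mapHomologicalComplex _).map φ.hom) c hc))

lemma app_leftDerivedDesc (P : ProjectiveResolution X) {F G : C ⥤ D} [F.Additive] [G.Additive]
    (α : F ⟶ G) (n : ℕ)
    {T : D} (c : G.obj (P.complex.X n) ⟶ T) (hc : G.map (P.complex.d (n + 1) n) ≫ c = 0)
    (hc' : F.map (P.complex.d (n + 1) n) ≫ α.app _ ≫ c = 0) :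
    (NatTrans.leftDerived α n).app X ≫ P.leftDerivedDesc G n c hc =
      P.leftDerivedDesc F n (α.app _ ≫ c) hc' := by
  have h : (NatTrans.leftDerived α n).app X ≫ (P.isoLeftDerivedObj G n).hom =
      (P.isoLeftDerivedObj F n).hom ≫ (HomologicalComplex.homologyFunctor D _ n).map
        ((NatTrans.mapHomologicalComplex α _).app P.complex) := by
    rw [P.leftDerived_app_eq α, Category.assoc, Category.assoc, Iso.inv_hom_id, Category.comp_id]
  refine (Category.assoc _ _ _).symm.trans ((congrArg (· ≫ _) h).trans
    ((Category.assoc _ _ _).trans ?_))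
  exact congrArg ((P.isoLeftDerivedObj F n).hom ≫ ·)
    (HomologicalComplex.homologyMap_homologyDesc n
      ((NatTrans.mapHomologicalComplex α _).app P.complex) c hc)

lemma leftDerivedDesc_comp (P : ProjectiveResolution X) (F : C ⥤ D) [F.Additive] (n : ℕ)
    {T T' : D} (c : F.obj (P.complex.X n) ⟶ T) (hc : F.map (P.complex.d (n + 1) n) ≫ c = 0)
    (g : T ⟶ T') (hc' : F.map (P.complex.d (n + 1) n) ≫ c ≫ g = 0) :
    P.leftDerivedDesc F n c hc ≫ g = P.leftDerivedDesc F n (c ≫ g) hc' :=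
  (Category.assoc _ _ _).trans (congrArg ((P.isoLeftDerivedObj F n).hom ≫ ·)
    (((F.mapHomologicalComplex _).obj P.complex).homologyDesc_comp n c hc g))

lemma leftDerivedDesc_sub (P : ProjectiveResolution X) (F : C ⥤ D) [F.Additive] (n : ℕ)
    {T : D} (c c' : F.obj (P.complex.X n) ⟶ T) (hc : F.map (P.complex.d (n + 1) n) ≫ c = 0)
    (hc' : F.map (P.complex.d (n + 1) n) ≫ c' = 0)
    (hcc' : F.map (P.complex.d (n + 1) n) ≫ (c - c') = 0) :
    P.leftDerivedDesc F n c hc - P.leftDerivedDesc F n c' hc' =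
      P.leftDerivedDesc F n (c - c') hcc' :=
  (Preadditive.comp_sub ..).symm.trans (congrArg ((P.isoLeftDerivedObj F n).hom ≫ ·)
    (((F.mapHomologicalComplex _).obj P.complex).homologyDesc_sub n c c' hc hc'))

end CategoryTheory.ProjectiveResolution

namespace CategoryTheory

section DerivedExt

universe w
variable (R : Type w) [CommRing R] {C : Type*} [Category.{w} C] [Abelian C] [Linear R C]

/-- The morphism in the opposite of the category of modules corresponding to an element `c`
of `A ⟶ Y`. -/
def elementOp {A Y : C} (c : A ⟶ Y) :
    ((linearYoneda R C).obj Y).rightOp.obj A ⟶ op (ModuleCat.of R R) :=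
  (ModuleCat.ofHom (LinearMap.toSpanSingleton R (A ⟶ Y) c)).op

variable {R} {A B X X' Y Y' : C}

lemma elementOp_ext {c c' : ((linearYoneda R C).obj Y).rightOp.obj A ⟶ op (ModuleCat.of R R)}
    (h : c.unop.hom 1 = c'.unop.hom 1) : c = c' :=
  Quiver.Hom.unop_inj (ModuleCat.hom_ext (LinearMap.ext_ring h))

lemma elementOp_surjective
    (c : ((linearYoneda R C).obj Y).rightOp.obj A ⟶ op (ModuleCat.of R R)) :
    ∃ c', elementOp R c' = c :=
  ⟨c.unop.hom 1, elementOp_ext (one_smul R (_ : A ⟶ Y))⟩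

lemma elementOp_unop_hom_one (c : A ⟶ Y) : (elementOp R c).unop.hom 1 = c :=
  one_smul R c

lemma elementOp_injective {c c' : A ⟶ Y} (h : elementOp R c = elementOp R c') : c = c' := by
  rw [← elementOp_unop_hom_one (R := R) c, h, elementOp_unop_hom_one]

lemma elementOp_zero : elementOp R (0 : A ⟶ Y) = 0 :=
  elementOp_ext (one_smul R (0 : A ⟶ Y))

lemma elementOp_sub (c c' : A ⟶ Y) : elementOp R (c - c') = elementOp R c - elementOp R c' :=
  elementOp_ext ((one_smul R (c - c')).trans
    (congrArg₂ (· - ·) (one_smul R c).symm (one_smul R c').symm))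

lemma map_elementOp (f : A ⟶ B) (c : B ⟶ Y) :
    ((linearYoneda R C).obj Y).rightOp.map f ≫ elementOp R c = elementOp R (f ≫ c) :=
  elementOp_ext ((congrArg (f ≫ ·) (one_smul R c)).trans (one_smul R (f ≫ c)).symm)

lemma app_elementOp (f : Y ⟶ Y') (c : A ⟶ Y) :
    (NatTrans.rightOp ((linearYoneda R C).map f)).app A ≫ elementOp R c = elementOp R (c ≫ f) :=
  elementOp_ext ((congrArg (· ≫ f) (one_smul R c)).trans (one_smul R (c ≫ f)).symm)

lemma elementOp_smul (r : R) (c : A ⟶ Y) :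
    elementOp R c ≫ (ModuleCat.ofHom (r • LinearMap.id)).op = elementOp R (r • c) :=
  elementOp_ext (by
    change (r • (1 : R)) • c = (1 : R) • r • c
    rw [smul_eq_mul, mul_one, one_smul])

namespace ProjectiveResolution

variable (P : ProjectiveResolution X) (n : ℕ)

lemma map_d_elementOp (c : P.complex.X n ⟶ Y) (hc : P.complex.d (n + 1) n ≫ c = 0) :
    ((linearYoneda R C).obj Y).rightOp.map (P.complex.d (n + 1) n) ≫ elementOp R c = 0 := by
  rw [map_elementOp, hc, elementOp_zero]

variable [EnoughProjectives C]

variable (R) in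
/-- The element of `Ext` attached to a cocycle of a projective resolution. -/
noncomputable def derivedExtMk (c : P.complex.X n ⟶ Y)
    (hc : P.complex.d (n + 1) n ≫ c = 0) : ((Ext R C n).obj (op X)).obj Y :=
  (P.leftDerivedDesc ((linearYoneda R C).obj Y).rightOp n (elementOp R c)
    (P.map_d_elementOp n c hc)).unop.hom 1

lemma derivedExtMk_surjective (y : ((Ext R C n).obj (op X)).obj Y) :
    ∃ c hc, P.derivedExtMk R n c hc = y := by
  have : Projective (ModuleCat.of R R) :=
    ModuleCat.projective_of_free (Module.Basis.singleton Unit R)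
  let y' : (((linearYoneda R C).obj Y).rightOp.leftDerived n).obj X ⟶ op (ModuleCat.of R R) :=
    (ModuleCat.ofHom (LinearMap.toSpanSingleton R _ y)).op
  obtain ⟨c, hc, h⟩ := P.leftDerivedDesc_surjective _ n y'
  obtain ⟨c, rfl⟩ := elementOp_surjective c
  refine ⟨c, ?_, ?_⟩
  · rw [map_elementOp] at hc
    exact elementOp_injective (hc.trans elementOp_zero.symm)
  · exact (congrArg (fun g ↦ g.unop.hom (1 : R)) h).trans (one_smul R y)

lemma derivedExtMk_eq_zero (c : P.complex.X n ⟶ Y)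
    (hc : P.complex.d (n + 1) n ≫ c = 0) (m : ℕ) (g : P.complex.X m ⟶ Y)
    (hg : P.complex.d n m ≫ g = c) : P.derivedExtMk R n c hc = 0 :=
  congrArg (fun g ↦ g.unop.hom (1 : R))
    (P.leftDerivedDesc_eq_zero ((linearYoneda R C).obj Y).rightOp n _
      (P.map_d_elementOp n c hc) m (elementOp R g) (by rw [map_elementOp, hg]))

lemma derivedExtMk_sub (c c' : P.complex.X n ⟶ Y)
    (hc : P.complex.d (n + 1) n ≫ c = 0) (hc' : P.complex.d (n + 1) n ≫ c' = 0) :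
    P.derivedExtMk R n (c - c') (by simp [hc, hc']) =
      P.derivedExtMk R n c hc - P.derivedExtMk R n c' hc' := by
  have := P.leftDerivedDesc_sub ((linearYoneda R C).obj Y).rightOp n _ _
    (P.map_d_elementOp n c hc) (P.map_d_elementOp n c' hc')
    (by rw [← elementOp_sub, map_elementOp, Preadditive.comp_sub, hc, hc', sub_zero,
      elementOp_zero])
  refine Eq.trans ?_ (congrArg (fun g ↦ g.unop.hom (1 : R)) this).symm
  simp only [derivedExtMk, elementOp_sub]
  rfl

lemma derivedExtMk_smul (r : R) (c : P.complex.X n ⟶ Y)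
    (hc : P.complex.d (n + 1) n ≫ c = 0) :
    P.derivedExtMk R n (r • c) (by simp [hc]) = r • P.derivedExtMk R n c hc := by
  have := P.leftDerivedDesc_comp ((linearYoneda R C).obj Y).rightOp n _
    (P.map_d_elementOp n c hc) (ModuleCat.ofHom (r • LinearMap.id)).op
    (by rw [reassoc_of% P.map_d_elementOp n c hc, zero_comp])
  have h := congrArg (fun g ↦ g.unop.hom (1 : R)) this
  simp only [elementOp_smul] at h
  refine h.symm.trans ?_
  refine Eq.trans (b := (P.leftDerivedDesc ((linearYoneda R C).obj Y).rightOp n (elementOp R c)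
    (P.map_d_elementOp n c hc)).unop.hom (r • (1 : R))) rfl ?_
  exact map_smul _ r (1 : R)

lemma map_derivedExtMk (f : Y ⟶ Y') (c : P.complex.X n ⟶ Y)
    (hc : P.complex.d (n + 1) n ≫ c = 0) :
    (((Ext R C n).obj (op X)).map f).hom (P.derivedExtMk R n c hc) =
      P.derivedExtMk R n (c ≫ f) (by rw [reassoc_of% hc, zero_comp]) := by
  have := P.app_leftDerivedDesc (NatTrans.rightOp ((linearYoneda R C).map f)) n _
    (P.map_d_elementOp n c hc) (by
      rw [app_elementOp, map_elementOp, reassoc_of% hc, zero_comp, elementOp_zero])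
  have h := congrArg (fun g ↦ g.unop.hom (1 : R)) this
  simp only [app_elementOp] at h
  exact h

variable {n} in
lemma derivedExtMk_precomp {P : ProjectiveResolution X} {P' : ProjectiveResolution X'}
    {f : X' ⟶ X} (φ : Hom P' P f) (c : P.complex.X n ⟶ Y)
    (hc : P.complex.d (n + 1) n ≫ c = 0) :
    (((Ext R C n).map f.op).app Y).hom (P.derivedExtMk R n c hc) =
      P'.derivedExtMk R n (φ.hom.f n ≫ c) (by rw [← φ.hom.comm_assoc, hc, comp_zero]) := by
  have := map_leftDerivedDesc φ ((linearYoneda R C).obj Y).rightOp n _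
    (P.map_d_elementOp n c hc) (by
      rw [map_elementOp, map_elementOp, ← φ.hom.comm_assoc, hc, comp_zero, elementOp_zero])
  have h := congrArg (fun g ↦ g.unop.hom (1 : R)) this
  simp only [map_elementOp] at h
  exact h

end ProjectiveResolution

end DerivedExt

end CategoryTheory

namespace CategoryTheory

section CompareExt

universe w
variable {R : Type w} [CommRing R] {C : Type*} [Category.{w} C] [Abelian C] [Linear R C]
  {X X' Y Y' : C} {n : ℕ}

open CochainComplex HomComplex in
lemma ProjectiveResolution.extMk_eq_zero_iff_exists [HasExt.{w} C] (P : ProjectiveResolution X)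
    (c : P.complex.X n ⟶ Y) (hc : P.complex.d (n + 1) n ≫ c = 0) :
    P.extMk c (n + 1) rfl hc = 0 ↔
      ∃ (m : ℕ) (g : P.complex.X m ⟶ Y), P.complex.d n m ≫ g = c := by
  refine ⟨fun h ↦ ?_, ?_⟩
  swap
  · rintro ⟨m, g, rfl⟩
    by_cases hm : m + 1 = n
    · exact (P.extMk_eq_zero_iff _ _ _ _ m hm).2 ⟨_, rfl⟩
    · have : P.complex.d n m ≫ g = 0 := by
        rw [P.complex.shape _ _ (by simpa using hm), zero_comp]
      simp only [this, extMk_zero]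
  obtain _ | n := n
  · refine ⟨0, 0, ?_⟩
    simp only [← P.extEquivCohomologyClass.apply_eq_iff_eq,
      extEquivCohomologyClass_extMk, extEquivCohomologyClass_zero,
      CohomologyClass.mk_eq_zero_iff] at h
    rw [Cocycle.toSingleMk_mem_coboundaries_iff _ _ _ _ _ 1 (by lia)] at h
    obtain ⟨g, hg⟩ := h
    have hz : IsZero (P.cochainComplex.X 1) :=
      P.cochainComplex.isZero_of_isStrictlyLE 0 1 (by lia)
    rw [hz.eq_of_src g 0, comp_zero] at hg
    rw [← cancel_epi (P.cochainComplexXIso (-((0 : ℕ) : ℤ)) 0 rfl).hom, ← hg, comp_zero, comp_zero]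
  · obtain ⟨g, hg⟩ := (P.extMk_eq_zero_iff c _ rfl hc n rfl).1 h
    exact ⟨n, g, hg⟩

variable [EnoughProjectives C] [HasExt.{w} C]

lemma exists_extMk_eq (e : Abelian.Ext X Y n) :
    ∃ (c : (projectiveResolution X).complex.X n ⟶ Y)
      (hc : (projectiveResolution X).complex.d (n + 1) n ≫ c = 0),
      (projectiveResolution X).extMk c (n + 1) rfl hc = e :=
  (projectiveResolution X).extMk_surjective e _ rfl

variable (R) in
/-- The comparison map from the `Ext`-groups of an abelian category to the left derived
functors of the Yoneda functor. -/
noncomputable def toDerivedExt (e : Abelian.Ext X Y n) : ((Ext R C n).obj (op X)).obj Y :=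
  (projectiveResolution X).derivedExtMk R n (exists_extMk_eq e).choose
    (exists_extMk_eq e).choose_spec.choose

lemma toDerivedExt_extMk (c : (projectiveResolution X).complex.X n ⟶ Y)
    (hc : (projectiveResolution X).complex.d (n + 1) n ≫ c = 0) :
    toDerivedExt R ((projectiveResolution X).extMk c (n + 1) rfl hc) =
      (projectiveResolution X).derivedExtMk R n c hc := by
  let e := (projectiveResolution X).extMk c (n + 1) rfl hc
  have h := (exists_extMk_eq e).choose_spec.choose_spec
  have h' := sub_eq_zero.2 h
  rw [ProjectiveResolution.sub_extMk] at h'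
  obtain ⟨m, g, hg⟩ := (ProjectiveResolution.extMk_eq_zero_iff_exists _ _ _).1 h'
  have := ProjectiveResolution.derivedExtMk_eq_zero (R := R) _ n _
    (by simp [(exists_extMk_eq e).choose_spec.choose, hc]) m g hg
  rw [ProjectiveResolution.derivedExtMk_sub _ _ _ _
    (exists_extMk_eq e).choose_spec.choose hc] at this
  exact sub_eq_zero.1 this

lemma toDerivedExt_surjective (y : ((Ext R C n).obj (op X)).obj Y) :
    ∃ e : Abelian.Ext X Y n, toDerivedExt R e = y := by
  obtain ⟨c, hc, rfl⟩ := (projectiveResolution X).derivedExtMk_surjective n y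
  exact ⟨_, toDerivedExt_extMk c hc⟩

lemma toDerivedExt_zero : toDerivedExt R (0 : Abelian.Ext X Y n) = 0 := by
  rw [← (projectiveResolution X).extMk_zero (n + 1) rfl, toDerivedExt_extMk]
  exact ProjectiveResolution.derivedExtMk_eq_zero _ _ _ _ n 0 comp_zero

lemma map_toDerivedExt (f : Y ⟶ Y') (e : Abelian.Ext X Y n) :
    (((Ext R C n).obj (op X)).map f).hom (toDerivedExt R e) =
      toDerivedExt R (e.comp (Abelian.Ext.mk₀ f) (add_zero n)) := by
  obtain ⟨c, hc, rfl⟩ := exists_extMk_eq e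
  rw [ProjectiveResolution.extMk_comp_mk₀, toDerivedExt_extMk, toDerivedExt_extMk,
    ProjectiveResolution.map_derivedExtMk]

lemma toDerivedExt_smul (r : R) (e : Abelian.Ext X Y n) :
    toDerivedExt R (r • e) = r • toDerivedExt R e := by
  obtain ⟨c, hc, rfl⟩ := exists_extMk_eq e
  rw [Abelian.Ext.smul_eq_comp_mk₀, ProjectiveResolution.extMk_comp_mk₀, toDerivedExt_extMk,
    toDerivedExt_extMk, ← ProjectiveResolution.derivedExtMk_smul]
  congr 1
  simp

variable (R) in
lemma map_op_toDerivedExt (f : X' ⟶ X) (e : Abelian.Ext X Y n) :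
    (((Ext R C n).map f.op).app Y).hom (toDerivedExt R e) =
      toDerivedExt R ((Abelian.Ext.mk₀ f).comp e (zero_add n)) := by
  obtain ⟨c, hc, rfl⟩ := exists_extMk_eq e
  let φ : ProjectiveResolution.Hom (projectiveResolution X') (projectiveResolution X) f :=
    { hom := ProjectiveResolution.lift f _ _
      hom_f_zero_comp_π_f_zero :=
        HomologicalComplex.congr_hom (ProjectiveResolution.lift_commutes f _ _) 0 }
  rw [ProjectiveResolution.mk₀_comp_extMk _ _ _ _ φ, toDerivedExt_extMk, toDerivedExt_extMk,
    ProjectiveResolution.derivedExtMk_precomp φ]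

end CompareExt

end CategoryTheory

namespace localCohomology

/-- The projection `R ⧸ I ⟶ R ⧸ I'` for `I ≤ I'`. -/
abbrev quotientMap {R : Type*} [CommRing R] {I I' : Ideal R} (h : I ≤ I') :
    ModuleCat.of R (R ⧸ I) ⟶ ModuleCat.of R (R ⧸ I') :=
  ModuleCat.ofHom (Submodule.mapQ I I' LinearMap.id h)

variable {R : Type} [CommRing R] (J : Ideal R) {n : ℕ} {M N : ModuleCat.{0} R}

/-- The canonical map from `Ext` of `R ⧸ J ^ t` to local cohomology. -/
noncomputable def fromExt (n : ℕ) (M : ModuleCat.{0} R) (t : ℕ) :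
    ((Ext R (ModuleCat.{0} R) n).obj (op (ModuleCat.of R (R ⧸ J ^ t)))).obj M ⟶
      (localCohomology J n).obj M :=
  (colimit.ι (diagram.{0, 0} (idealPowersDiagram J) n) (op (op t))).app M

lemma fromExt_surjective (y : (localCohomology J n).obj M) :
    ∃ t x, (fromExt J n M t).hom x = y := by
  let F := diagram.{0, 0} (idealPowersDiagram J) n
  have hc := isColimitOfPreserves ((evaluation _ _).obj M) (colimit.isColimit F)
  obtain ⟨⟨⟨t⟩⟩, x, hx⟩ := Concrete.isColimit_exists_rep _ hc y
  exact ⟨t, x, hx⟩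

lemma map_quotientMap_comp_fromExt {t s : ℕ} (h : t ≤ s) :
    ((Ext R (ModuleCat.{0} R) n).map (quotientMap (Ideal.pow_le_pow_right h)).op).app M ≫
      fromExt J n M s = fromExt J n M t :=
  congrArg (fun f ↦ f.app M)
    (colimit.w (diagram.{0, 0} (idealPowersDiagram J) n) (homOfLE h).op.op)

lemma fromExt_comp_map (f : M ⟶ N) (t : ℕ) :
    fromExt J n M t ≫ (localCohomology J n).map f =
      ((Ext R (ModuleCat.{0} R) n).obj (op (ModuleCat.of R (R ⧸ J ^ t)))).map f ≫
        fromExt J n N t :=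
  ((colimit.ι (diagram.{0, 0} (idealPowersDiagram J) n) (op (op t))).naturality f).symm

/-- The element of local cohomology given by an extension class of `R ⧸ J ^ t`. -/
noncomputable def ofExt (t : ℕ) (e : Abelian.Ext (ModuleCat.of R (R ⧸ J ^ t)) M n) :
    (localCohomology J n).obj M :=
  (fromExt J n M t).hom (toDerivedExt R e)

lemma ofExt_surjective (y : (localCohomology J n).obj M) :
    ∃ t e, ofExt J t e = y := by
  obtain ⟨t, x, rfl⟩ := fromExt_surjective J y
  obtain ⟨e, rfl⟩ := toDerivedExt_surjective (R := R) x
  exact ⟨t, e, rfl⟩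

lemma ofExt_comp {t s : ℕ} (h : t ≤ s) (e : Abelian.Ext (ModuleCat.of R (R ⧸ J ^ t)) M n) :
    ofExt J s ((Abelian.Ext.mk₀ (quotientMap (Ideal.pow_le_pow_right h))).comp e (zero_add n)) =
      ofExt J t e := by
  rw [ofExt, ← map_op_toDerivedExt, ← ModuleCat.comp_apply, map_quotientMap_comp_fromExt J h, ofExt]

lemma map_ofExt (f : M ⟶ N) (t : ℕ) (e : Abelian.Ext (ModuleCat.of R (R ⧸ J ^ t)) M n) :
    ((localCohomology J n).map f).hom (ofExt J t e) =
      ofExt J t (e.comp (Abelian.Ext.mk₀ f) (add_zero n)) := by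
  rw [ofExt, ofExt, ← map_toDerivedExt, ← ModuleCat.comp_apply, ← ModuleCat.comp_apply,
    fromExt_comp_map]

lemma ofExt_smul (r : R) (t : ℕ) (e : Abelian.Ext (ModuleCat.of R (R ⧸ J ^ t)) M n) :
    ofExt J t (r • e) = r • ofExt J t e := by
  rw [ofExt, toDerivedExt_smul, map_smul, ofExt]

lemma ofExt_zero (t : ℕ) :
    ofExt J t (0 : Abelian.Ext (ModuleCat.of R (R ⧸ J ^ t)) M n) = 0 := by
  rw [ofExt, toDerivedExt_zero, map_zero]

variable {J}

lemma map_smul_id (r : R) (y : (localCohomology J n).obj M) :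
    ((localCohomology J n).map (r • 𝟙 M)).hom y = r • y := by
  obtain ⟨t, e, rfl⟩ := ofExt_surjective J y
  rw [map_ofExt, ← Abelian.Ext.smul_eq_comp_mk₀, ofExt_smul]

lemma exists_pow_smul_eq_zero {r : R} (hr : r ∈ J) (y : (localCohomology J n).obj M) :
    ∃ t : ℕ, r ^ t • y = 0 := by
  obtain ⟨t, e, rfl⟩ := ofExt_surjective J y
  refine ⟨t, ?_⟩
  have h : r ^ t • 𝟙 (ModuleCat.of R (R ⧸ J ^ t)) = 0 := by
    ext
    exact Ideal.Quotient.eq_zero_iff_mem.2 ((J ^ t).mul_mem_right 1 (Ideal.pow_mem_pow hr t))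
  rw [← ofExt_smul, ← Abelian.Ext.mk₀_id_comp e, ← Abelian.Ext.smul_comp, ← Abelian.Ext.mk₀_smul,
    h, Abelian.Ext.mk₀_zero, Abelian.Ext.zero_comp, ofExt_zero]

/-- If `r` acts surjectively on a local cohomology module of finite length, and `r` belongs to
the support ideal, then this module vanishes. -/
lemma eq_zero_of_smul_surjective {r : R} (hr : r ∈ J)
    [IsNoetherian R ((localCohomology J n).obj M)]
    (h : ∀ y : (localCohomology J n).obj M, ∃ z, r • z = y) (y : (localCohomology J n).obj M) :
    y = 0 := by
  have inj : Function.Injective (LinearMap.lsmul R ((localCohomology J n).obj M) r) :=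
    IsNoetherian.injective_of_surjective_endomorphism _ fun y ↦ h y
  obtain ⟨t, ht⟩ := exists_pow_smul_eq_zero hr y
  induction t with
  | zero => simpa using ht
  | succ t ih =>
    refine ih (inj ?_)
    rw [map_zero, LinearMap.lsmul_apply, ← mul_smul, ← pow_succ', ht]

/-- If an endomorphism of the form `r ^ k` factors through a module on whose local cohomology
`r` acts surjectively, then `r ^ k` annihilates local cohomology of finite length. -/
lemma pow_smul_eq_zero_of_factor {r : R} (hr : r ∈ J) (k : ℕ) (f : M ⟶ N) (g : N ⟶ M)
    (hfg : f ≫ g = r ^ k • 𝟙 M) (hgf : g ≫ f = r ^ k • 𝟙 N)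
    [IsNoetherian R ((localCohomology J n).obj M)]
    (h : ∀ y : (localCohomology J n).obj N, ∃ z, r • z = y) (y : (localCohomology J n).obj M) :
    r ^ k • y = 0 := by
  have h' (l : ℕ) (y : (localCohomology J n).obj N) : ∃ z, r ^ l • z = y := by
    induction l generalizing y with
    | zero => exact ⟨y, by simp⟩
    | succ l ih =>
      obtain ⟨z, rfl⟩ := ih y
      obtain ⟨w, rfl⟩ := h z
      exact ⟨w, by rw [pow_succ, mul_smul]⟩
  have surj : Function.Surjective ((localCohomology J n).map f).hom := fun y ↦ by
    obtain ⟨z, rfl⟩ := h' k y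
    refine ⟨((localCohomology J n).map g).hom z, ?_⟩
    rw [← map_smul_id, ← hgf, Functor.map_comp, ModuleCat.comp_apply]
  have : IsNoetherian R ((localCohomology J n).obj N) := isNoetherian_of_surjective _
    (LinearMap.range_eq_top.2 surj)
  rw [← map_smul_id, ← hfg, Functor.map_comp, ModuleCat.comp_apply,
    eq_zero_of_smul_surjective hr h (((localCohomology J n).map f).hom y), map_zero]

end localCohomology

namespace CategoryTheory

lemma Adjunction.exists_map_comp_eq {C D : Type*} [Category* C] [Category* D] {F : C ⥤ D}
    {G : D ⥤ C} (adj : F ⊣ G) {Y Z : D} (a : Y ⟶ Z) (r : G.obj Z ⟶ G.obj Y)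
    (h : G.map a ≫ r = 𝟙 _) {X X' : C} (d : X ⟶ X') (c : F.obj X ⟶ Y) (g : F.obj X' ⟶ Z)
    (hg : F.map d ≫ g = c ≫ a) : ∃ g', F.map d ≫ g' = c := by
  refine ⟨(adj.homEquiv _ _).symm (adj.homEquiv _ _ g ≫ r), (adj.homEquiv _ _).injective ?_⟩
  rw [adj.homEquiv_naturality_left, Equiv.apply_symm_apply, ← Category.assoc,
    ← adj.homEquiv_naturality_left, hg, adj.homEquiv_naturality_right, Category.assoc, h,
    Category.comp_id]

universe w in
/-- Let `F ⊣ G` be an adjunction between abelian categories such that `F` is exact and preserves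
projective objects. If `G.map a` is a split monomorphism, then postcomposition with `a` is
injective on `Ext`-groups whose source is in the image of `F`. -/
lemma Adjunction.ext_eq_zero_of_comp_eq_zero {C D : Type*} [Category* C] [Category.{w} D]
    [Abelian C] [Abelian D] [HasExt.{w} D] [HasProjectiveResolutions C] {F : C ⥤ D} {G : D ⥤ C}
    (adj : F ⊣ G) [F.Additive] [F.PreservesHomology] [F.PreservesProjectiveObjects]
    {X : C} {Y Z : D} (a : Y ⟶ Z) (r : G.obj Z ⟶ G.obj Y) (h : G.map a ≫ r = 𝟙 _) {n : ℕ}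
    (e : Abelian.Ext (F.obj X) Y n) (he : e.comp (Abelian.Ext.mk₀ a) (add_zero n) = 0) :
    e = 0 := by
  let P := F.mapProjectiveResolution (projectiveResolution X)
  obtain ⟨c, hc, rfl⟩ := P.extMk_surjective e _ rfl
  rw [ProjectiveResolution.extMk_comp_mk₀, ProjectiveResolution.extMk_eq_zero_iff_exists] at he
  obtain ⟨m, g, hg⟩ := he
  exact (P.extMk_eq_zero_iff_exists _ _).2 ⟨m, adj.exists_map_comp_eq a r h _ c g hg⟩

section

universe u
variable {A S : Type u} [CommRing A] [CommRing S] (f : A →+* S)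

/-- Extension of scalars of `A ⧸ I`. -/
noncomputable def extendScalarsQuotientIso (I : Ideal A) :
    (ModuleCat.extendScalars.{u, u, u} f).obj (ModuleCat.of A (A ⧸ I)) ≅
      ModuleCat.of S (S ⧸ I.map f) :=
  letI := f.toAlgebra
  (Algebra.TensorProduct.quotIdealMapEquivTensorQuot S I).toLinearEquiv.symm.toModuleIso

variable {f} in
/-- If multiplication by `x` on `Y` has a retraction which is linear over a subring `A` of `S` such
that `S` is flat over `A`, then `x` acts injectively on `Ext` of quotients of `S` by ideals
extended from `A`. -/
lemma ext_quotient_map_eq_zero (hf : f.Flat) (I : Ideal A) {Y : ModuleCat.{u} S} (x : S)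
    (r : (ModuleCat.restrictScalars f).obj Y ⟶ (ModuleCat.restrictScalars f).obj Y)
    (h : ∀ y : Y, r.hom (x • y : Y) = y) {n : ℕ}
    (e : Abelian.Ext (ModuleCat.of S (S ⧸ I.map f)) Y n) (he : x • e = 0) : e = 0 := by
  have := ModuleCat.preservesFiniteLimits_extendScalars_of_flat hf
  have : (ModuleCat.extendScalars.{u, u, u} f).PreservesProjectiveObjects :=
    Functor.preservesProjectiveObjects_of_adjunction_of_preservesEpimorphisms
      (ModuleCat.extendRestrictScalarsAdj f)
  have : (ModuleCat.extendScalars.{u, u, u} f).Additive :=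
    (ModuleCat.extendRestrictScalarsAdj f).left_adjoint_additive
  let i := extendScalarsQuotientIso f I
  have hi := (ModuleCat.extendRestrictScalarsAdj f).ext_eq_zero_of_comp_eq_zero (x • 𝟙 Y) r
    (by ext y; exact h y) ((Abelian.Ext.mk₀ i.hom).comp e (zero_add n))
    (by rw [Abelian.Ext.comp_assoc_of_third_deg_zero, ← Abelian.Ext.smul_eq_comp_mk₀, he,
      Abelian.Ext.comp_zero])
  rw [← Abelian.Ext.mk₀_id_comp e, ← i.inv_hom_id, ← Abelian.Ext.mk₀_comp_mk₀_assoc, hi,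
    Abelian.Ext.comp_zero]

end

end CategoryTheory

namespace CategoryTheory.Abelian.Ext

universe w
variable {R : Type*} [Ring R] {C : Type*} [Category* C] [Abelian C] [Linear R C] [HasExt.{w} C]

/-- Given exact sequences `0 ⟶ P ⟶ P ⟶ Q ⟶ 0` and `0 ⟶ P ⟶ P ⟶ Q' ⟶ 0` with first maps `a`
and `r • a`, an extension class of `Q` which vanishes on `P` becomes divisible by `r` on `Q'`. -/
lemma exists_smul_eq_mk₀_comp {P Q Q' Y : C} {a : P ⟶ P} {g : P ⟶ Q} {g' : P ⟶ Q'}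
    {r : R} {w : a ≫ g = 0} {w' : (r • a) ≫ g' = 0} (h : (ShortComplex.mk a g w).ShortExact)
    (h' : (ShortComplex.mk (r • a) g' w').ShortExact) (q : Q' ⟶ Q) (hq : g' ≫ q = g) {n : ℕ}
    (e : Ext Q Y n) (he : (mk₀ g).comp e (zero_add n) = 0) :
    ∃ z : Ext Q' Y n, r • z = (mk₀ q).comp e (zero_add n) := by
  obtain _ | n := n
  · have : Epi g := h.epi_g
    have h0 : (mk₀ g).comp e (zero_add 0) = (mk₀ g).comp 0 (zero_add 0) := by
      rw [he, comp_zero]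
    have : e = 0 := precomp_mk₀_injective_of_epi Y g h0
    exact ⟨0, by rw [this, smul_zero, comp_zero]⟩
  · obtain ⟨d, rfl⟩ : ∃ d, h.extClass.comp d (add_comm 1 n) = e :=
      contravariant_sequence_exact₃ h Y e he (add_comm 1 n)
    let φ : ShortComplex.mk (r • a) g' w' ⟶ ShortComplex.mk a g w :=
      { τ₁ := r • 𝟙 P
        τ₂ := 𝟙 P
        τ₃ := q
        comm₁₂ := by simp
        comm₂₃ := by simp [hq] }
    have hφ : h'.extClass.comp (mk₀ (r • 𝟙 P)) (add_zero 1) =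
      (mk₀ q).comp h.extClass (zero_add 1) := h'.extClass_naturality h φ
    refine ⟨h'.extClass.comp d (add_comm 1 n), ?_⟩
    rw [← comp_assoc _ _ _ (zero_add 1) (add_comm 1 n) (by lia), ← hφ,
      comp_assoc _ _ _ _ (zero_add n) (by lia), mk₀_smul, smul_comp, comp_smul, mk₀_id_comp]

end CategoryTheory.Abelian.Ext

namespace localCohomology

universe u
variable {R : Type u} [CommRing R] {I : Ideal R} {x : R}

lemma smul_id_comp_quotientMap (x : R) :
    (x • 𝟙 (ModuleCat.of R (R ⧸ I))) ≫
      quotientMap (le_sup_left : I ≤ I ⊔ Ideal.span {x}) = 0 := by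
  ext
  exact Ideal.Quotient.eq_zero_iff_mem.2
    (le_sup_right (a := I) (Ideal.mul_mem_right 1 _ (Ideal.mem_span_singleton_self x)))

/-- If `x` is regular on `R ⧸ I`, the sequence `0 ⟶ R ⧸ I ⟶ R ⧸ I ⟶ R ⧸ (I + (x)) ⟶ 0` is
exact. -/
lemma shortExact_smul_quotientMap (h : ∀ r, x * r ∈ I → r ∈ I) :
    (ShortComplex.mk _ _ (smul_id_comp_quotientMap (I := I) x)).ShortExact := by
  refine .mk' ?_ ?_ ?_
  · rw [ShortComplex.moduleCat_exact_iff]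
    intro (y : R ⧸ I) hy
    obtain ⟨y, rfl⟩ := Ideal.Quotient.mk_surjective y
    obtain ⟨a, ha, b, hb, rfl⟩ := Submodule.mem_sup.1 (Ideal.Quotient.eq_zero_iff_mem.1 hy)
    obtain ⟨c, rfl⟩ := Ideal.mem_span_singleton.1 hb
    refine ⟨Ideal.Quotient.mk I c, ?_⟩
    refine Ideal.Quotient.eq.2 ?_
    change x * c - (a + x * c) ∈ I
    simpa using ha
  · rw [ModuleCat.mono_iff_injective, injective_iff_map_eq_zero]
    intro (y : R ⧸ I) hy
    obtain ⟨y, rfl⟩ := Ideal.Quotient.mk_surjective y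
    exact Ideal.Quotient.eq_zero_iff_mem.2 (h y (Ideal.Quotient.eq_zero_iff_mem.1 hy))
  · rw [ModuleCat.epi_iff_surjective]
    exact Ideal.Quotient.factor_surjective (le_sup_left : I ≤ I ⊔ Ideal.span {x})

lemma sup_span_pow_succ_le (I : Ideal R) (x : R) (s : ℕ) :
    I ⊔ Ideal.span {x ^ (s + 1)} ≤ I ⊔ Ideal.span {x ^ s} :=
  sup_le_sup_left (Ideal.span_singleton_le_span_singleton.2 (pow_dvd_pow x s.le_succ)) I

/-- If `x` is regular on `R ⧸ I` and acts injectively on the `Ext`-groups of `R ⧸ I`, then any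
extension class of `R ⧸ (I + (x ^ s))` becomes divisible by `x` on `R ⧸ (I + (x ^ (s + 1)))`. -/
lemma exists_smul_eq_quotientMap_comp (h : ∀ r, x * r ∈ I → r ∈ I) {Y : ModuleCat.{u} R} {n : ℕ}
    (hY : ∀ e : Abelian.Ext (ModuleCat.of R (R ⧸ I)) Y n, x • e = 0 → e = 0) (s : ℕ)
    (e : Abelian.Ext (ModuleCat.of R (R ⧸ (I ⊔ Ideal.span {x ^ s}))) Y n) :
    ∃ z : Abelian.Ext (ModuleCat.of R (R ⧸ (I ⊔ Ideal.span {x ^ (s + 1)}))) Y n,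
      x • z =
        (Abelian.Ext.mk₀ (quotientMap (sup_span_pow_succ_le I x s))).comp e (zero_add n) := by
  have h' (s : ℕ) (r) (hr : x ^ s * r ∈ I) : r ∈ I := by
    induction s with
    | zero => simpa using hr
    | succ s ih => exact ih (h _ (by rwa [← mul_assoc, ← pow_succ']))
  have hY' (s : ℕ) (e : Abelian.Ext (ModuleCat.of R (R ⧸ I)) Y n) (he : x ^ s • e = 0) : e = 0 := by
    induction s with
    | zero => simpa using he
    | succ s ih => exact ih (hY _ (by rwa [← mul_smul, ← pow_succ']))
  have hx : x ^ (s + 1) • 𝟙 (ModuleCat.of R (R ⧸ I)) = x • x ^ s • 𝟙 _ := by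
    rw [smul_smul, pow_succ']
  have hs := shortExact_smul_quotientMap (h' (s + 1))
  have w' := smul_id_comp_quotientMap (I := I) (x ^ (s + 1))
  simp only [hx] at hs w'
  refine Abelian.Ext.exists_smul_eq_mk₀_comp (shortExact_smul_quotientMap (h' s)) hs _
    (by ext; rfl) e (hY' s _ ?_)
  rw [← Abelian.Ext.smul_comp, ← Abelian.Ext.mk₀_smul, ← Category.id_comp (quotientMap _),
    ← Linear.smul_comp, smul_id_comp_quotientMap, Abelian.Ext.mk₀_zero, Abelian.Ext.zero_comp]

end localCohomology

lemma Ideal.map_mem_of_semilinear {A S : Type*} [CommRing A] [CommRing S] {f : A →+* S}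
    (ρ : S →+ S) (hρ : ∀ a s, ρ (f a * s) = f a * ρ s) (I : Ideal A) {s : S} (hs : s ∈ I.map f) :
    ρ s ∈ I.map f := by
  induction hs using Submodule.span_induction generalizing ρ with
  | mem s hs =>
    obtain ⟨a, ha, rfl⟩ := hs
    have := hρ a 1
    rw [mul_one] at this
    exact this ▸ (I.map f).mul_mem_right _ (Ideal.mem_map_of_mem f ha)
  | zero => exact (map_zero ρ).symm ▸ zero_mem _
  | add s t _ _ hs ht => exact (map_add ρ s t).symm ▸ add_mem (hs ρ hρ) (ht ρ hρ)
  | smul b s _ hs =>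
    refine hs (ρ.comp (AddMonoidHom.mulLeft b)) fun a s ↦ ?_
    simp [← hρ, mul_left_comm]

namespace localCohomology

/-- Let `S` be a flat `A`-algebra with an element `x` such that multiplication by `x` has an
`A`-linear retraction `ρ`. If `I` is the sum of `(x)` and an ideal extended from `A`, then `x` acts
surjectively on local cohomology with support in `I` of quotients by ideals extended from `A`. -/
lemma smul_surjective_of_retraction {A S : Type} [CommRing A] [CommRing S] {f : A →+* S}
    (hf : f.Flat) (x : S) (ρ : S →+ S) (hρ : ∀ a s, ρ (f a * s) = f a * ρ s)
    (hx : ∀ s, ρ (x * s) = s) (𝔞 J : Ideal A) {I : Ideal S} (hI : I = 𝔞.map f ⊔ Ideal.span {x})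
    {n : ℕ} (y : (localCohomology I n).obj (ModuleCat.of S (S ⧸ J.map f))) :
    ∃ z, x • z = y := by
  let r : (ModuleCat.restrictScalars f).obj (ModuleCat.of S (S ⧸ J.map f)) ⟶
      (ModuleCat.restrictScalars f).obj (ModuleCat.of S (S ⧸ J.map f)) :=
    ModuleCat.ofHom (Y := (ModuleCat.restrictScalars f).obj (ModuleCat.of S (S ⧸ J.map f)))
      (X := (ModuleCat.restrictScalars f).obj (ModuleCat.of S (S ⧸ J.map f)))
      { toFun := QuotientAddGroup.map (J.map f).toAddSubgroup (J.map f).toAddSubgroup ρ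
          fun s hs ↦ Ideal.map_mem_of_semilinear ρ hρ J hs
        map_add' := map_add _
        map_smul' := fun a (y : S ⧸ J.map f) ↦ by
          obtain ⟨s, rfl⟩ := Ideal.Quotient.mk_surjective y
          exact congrArg (Ideal.Quotient.mk (J.map f)) (hρ a s) }
  have hr (y : ModuleCat.of S (S ⧸ J.map f)) :
      r.hom (x • y : ModuleCat.of S (S ⧸ J.map f)) = y := by
    obtain ⟨s, rfl⟩ := Ideal.Quotient.mk_surjective y
    exact congrArg (Ideal.Quotient.mk (J.map f)) (hx s)
  obtain ⟨t, e, rfl⟩ := ofExt_surjective I y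
  have h1 : (𝔞 ^ t).map f ⊔ Ideal.span {x ^ t} ≤ I ^ t := by
    rw [hI, Ideal.map_pow, ← Ideal.span_singleton_pow]
    exact sup_le (Ideal.pow_right_mono le_sup_left t) (Ideal.pow_right_mono le_sup_right t)
  have h2 : I ^ (t + (t + 1)) ≤ (𝔞 ^ t).map f ⊔ Ideal.span {x ^ (t + 1)} := by
    rw [hI, Ideal.map_pow, ← Ideal.span_singleton_pow]
    exact Ideal.sup_pow_add_le_pow_sup_pow
  have hq : (quotientMap h2 ≫ quotientMap (sup_span_pow_succ_le _ x t)) ≫ quotientMap h1 =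
      quotientMap (Ideal.pow_le_pow_right (Nat.le_add_right t (t + 1))) := by
    ext
    rfl
  obtain ⟨z, hz⟩ := exists_smul_eq_quotientMap_comp
    (fun s hs ↦ hx s ▸ Ideal.map_mem_of_semilinear ρ hρ (𝔞 ^ t) hs)
    (fun e he ↦ ext_quotient_map_eq_zero hf (𝔞 ^ t) x r hr e he) t
    ((Abelian.Ext.mk₀ (quotientMap h1)).comp e (zero_add n))
  refine ⟨ofExt I (t + (t + 1)) ((Abelian.Ext.mk₀ (quotientMap h2)).comp z (zero_add n)), ?_⟩
  rw [← ofExt_smul, ← Abelian.Ext.comp_smul, hz, Abelian.Ext.mk₀_comp_mk₀_assoc,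
    Abelian.Ext.mk₀_comp_mk₀_assoc, hq,
    ofExt_comp I (Nat.le_add_right t (t + 1))]

end localCohomology

end

namespace MvPolynomial

section

variable {σ K : Type*} [CommRing K] (j : σ)

lemma X_pow_mul_rename_monomial_subtypeDomain (u : σ →₀ ℕ) :
    X j ^ u j * rename Subtype.val (monomial (u.subtypeDomain (· ≠ j)) (1 : K)) =
      monomial u 1 := by
  rw [rename_monomial, X_pow_eq_monomial, monomial_mul, one_mul]
  refine congrArg (monomial · 1) (Finsupp.ext fun i ↦ ?_)
  by_cases hi : i = j
  · subst hi
    rw [Finsupp.add_apply, Finsupp.mapDomain_of_notMem_range _ _ (by simp)]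
    simp
  · rw [Finsupp.add_apply, Finsupp.single_eq_of_ne hi, zero_add]
    exact Finsupp.mapDomain_apply Subtype.val_injective _ (⟨i, hi⟩ : {i // i ≠ j})

lemma exists_ringEquiv_polynomial :
    ∃ e : MvPolynomial σ K ≃+* Polynomial (MvPolynomial {i // i ≠ j} K),
      e (X j) = Polynomial.X ∧
        ∀ a, e (rename Subtype.val a) = Polynomial.C a := by
  classical
  let e := (renameEquiv K (Equiv.optionSubtypeNe j).symm).trans (optionEquivLeft K {i // i ≠ j})
  refine ⟨e.toRingEquiv, by simp [e], fun a ↦ ?_⟩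
  have h : e.toRingEquiv.toRingHom.comp (rename Subtype.val).toRingHom = Polynomial.C := by
    ext i
    · simp [e]
    · simp [e, i.2]
  exact congrArg (fun g : _ →+* _ ↦ g a) h

lemma rename_val_flat :
    (rename (R := K) (Subtype.val : {i // i ≠ j} → σ)).toRingHom.Flat := by
  obtain ⟨e, -, he⟩ := exists_ringEquiv_polynomial (K := K) j
  have h : (rename (R := K) (Subtype.val : {i // i ≠ j} → σ)).toRingHom =
      e.symm.toRingHom.comp Polynomial.C :=
    RingHom.ext fun a ↦ (e.symm_apply_eq.2 (he a).symm).symm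
  have hC : (Polynomial.C : MvPolynomial {i // i ≠ j} K →+* _).Flat := by
    rw [← Polynomial.algebraMap_eq, RingHom.flat_algebraMap_iff]
    infer_instance
  exact h ▸ hC.comp (.of_bijective e.symm.bijective)

lemma exists_retraction_X_mul :
    ∃ ρ : MvPolynomial σ K →+ MvPolynomial σ K,
      (∀ (a : MvPolynomial {i // i ≠ j} K) s,
        ρ (rename Subtype.val a * s) = rename Subtype.val a * ρ s) ∧ ∀ s, ρ (X j * s) = s := by
  obtain ⟨e, heX, he⟩ := exists_ringEquiv_polynomial (K := K) j
  refine ⟨e.symm.toAddMonoidHom.comp (Polynomial.divX_hom.comp e.toAddMonoidHom),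
    fun a s ↦ e.injective ?_, fun s ↦ e.injective ?_⟩
  · simp [he, Polynomial.divX_C_mul]
  · ext
    simp [heX, Polynomial.coeff_divX]

lemma idealOfVars_eq_map_sup_span :
    idealOfVars σ K =
      (idealOfVars {i // i ≠ j} K).map (rename Subtype.val).toRingHom ⊔ Ideal.span {X j} := by
  rw [idealOfVars, idealOfVars, Ideal.map_span, ← Ideal.span_union]
  congr 1
  ext p
  constructor
  · rintro ⟨i, rfl⟩
    by_cases hi : i = j
    · exact .inr (hi ▸ rfl)
    · exact .inl ⟨_, ⟨⟨i, hi⟩, rfl⟩, by simp⟩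
  · rintro (⟨_, ⟨i, rfl⟩, rfl⟩ | rfl)
    · exact ⟨i, by simp⟩
    · exact ⟨j, rfl⟩

end

lemma smul_X_surjective {σ K : Type} [CommRing K] (j : σ)
    (J : Ideal (MvPolynomial {i // i ≠ j} K)) {n : ℕ}
    (y : (localCohomology (idealOfVars σ K) n).obj
      (ModuleCat.of _ (MvPolynomial σ K ⧸ J.map (rename (R := K) Subtype.val).toRingHom))) :
    ∃ z, (X j : MvPolynomial σ K) • z = y := by
  obtain ⟨ρ, hρ, hX⟩ := exists_retraction_X_mul (K := K) j
  exact localCohomology.smul_surjective_of_retraction (rename_val_flat j) (X j) ρ hρ hX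
    (idealOfVars _ K) J (idealOfVars_eq_map_sup_span j) y

end MvPolynomial

namespace GH

lemma X_pow_rho_smul_eq_zero {K : Type} [Field K] {n : ℕ} (G : Finset (Expo n)) (j : Fin n)
    {i : ℕ} [IsNoetherian (MvPolynomial (Fin n) K) (locCoh K (monIdeal K G) i)]
    (y : locCoh K (monIdeal K G) i) :
    (X j ^ rho G j : MvPolynomial (Fin n) K) • y = 0 := by
  let f := (rename (R := K) (Subtype.val : {l // l ≠ j} → Fin n)).toRingHom
  let J : Ideal (MvPolynomial {l // l ≠ j} K) :=
    Ideal.span ((fun u ↦ monomial (u.subtypeDomain (· ≠ j)) 1) '' (G : Set (Expo n)))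
  have h1 : monIdeal K G ≤ J.map f := by
    refine Ideal.span_le.2 ?_
    rintro _ ⟨u, hu, rfl⟩
    change monomial u 1 ∈ J.map f
    rw [← X_pow_mul_rename_monomial_subtypeDomain j u]
    exact Ideal.mul_mem_left _ _ (Ideal.mem_map_of_mem f (Ideal.subset_span ⟨u, hu, rfl⟩))
  have h2 : J.map f ≤
      Submodule.comap (LinearMap.mulLeft (MvPolynomial (Fin n) K) (X j ^ rho G j))
        (monIdeal K G) := by
    rw [Ideal.map_span]
    refine Ideal.span_le.2 ?_
    rintro _ ⟨_, ⟨u, hu, rfl⟩, rfl⟩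
    have hle : u j ≤ rho G j := Finset.le_sup (f := fun u : Expo n ↦ u j) hu
    change X j ^ rho G j * rename Subtype.val (monomial (u.subtypeDomain (· ≠ j)) (1 : K)) ∈
      monIdeal K G
    rw [← Nat.sub_add_cancel hle, pow_add, mul_assoc,
      X_pow_mul_rename_monomial_subtypeDomain j u]
    exact Ideal.mul_mem_left _ _ (Ideal.subset_span ⟨u, hu, rfl⟩)
  have : IsNoetherian (MvPolynomial (Fin n) K) ((localCohomology (idealM K n) i).obj
    (ModuleCat.of _ (MvPolynomial (Fin n) K ⧸ monIdeal K G))) :=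
    inferInstanceAs (IsNoetherian _ (locCoh K (monIdeal K G) i))
  refine localCohomology.pow_smul_eq_zero_of_factor (J := idealM K n)
    (Ideal.subset_span ⟨j, rfl⟩) (rho G j)
    (localCohomology.quotientMap h1) (ModuleCat.ofHom (Submodule.mapQ _ _ _ h2)) ?_ ?_
    (smul_X_surjective j J) y
  · ext
    rfl
  · ext
    rfl

lemma idealM_pow_le_of_X_pow_rho_mem {K : Type} [Field K] {n : ℕ} (G : Finset (Expo n)) {k : ℕ}
    (hk : (k : ℤ) = (∑ j, (rho G j : ℤ)) - n + 1) {I : Ideal (MvPolynomial (Fin n) K)}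
    (hI : ∀ j, X j ^ rho G j ∈ I) : idealM K n ^ k ≤ I := by
  rw [idealM, pow_idealOfVars_eq_span]
  refine Ideal.span_le.2 ?_
  rintro _ ⟨u, hu, rfl⟩
  obtain ⟨j, hj⟩ : ∃ j, rho G j ≤ u j := by
    by_contra! h
    have hsum : ∑ j, ((u j : ℤ) + 1) ≤ ∑ j, (rho G j : ℤ) :=
      Finset.sum_le_sum fun j _ ↦ by exact_mod_cast h j
    have hu' : ∑ j, u j = k := (Finsupp.degree_eq_sum u).symm.trans hu
    rw [Finset.sum_add_distrib, ← Nat.cast_sum, hu'] at hsum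
    simp at hsum
    lia
  refine I.mem_of_dvd ?_ (hI j)
  rw [X_pow_eq_monomial]
  exact monomial_dvd_monomial.2 (by simpa using hj)

variable (K : Type) [Field K]

/-- **Proposition 1.5.** Let `I ⊆ S` be a generalized Cohen–Macaulay
monomial ideal. Then `R = S/I` is `(Σ_{j=1}^n ρ_j - n + 1)`-Buchsbaum, i.e.
`𝔪^k H^i_𝔪(R) = 0` for all `i ≠ dim R`, where `k = Σ_{j=1}^n ρ_j - n + 1`. -/
theorem genCM_is_k_Buchsbaum {n : ℕ} (G : Finset (Expo n)) (hG : MinGens G)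
    (hgcm : IsGenCM K (monIdeal K G))
    (k : ℕ) (hk : (k : ℤ) = (∑ j, (rho G j : ℤ)) - n + 1) :
    ∀ i : ℕ,
      (i : WithBot (WithTop ℕ)) ≠ ringKrullDim (MvPolynomial (Fin n) K ⧸ monIdeal K G) →
      ∀ x ∈ idealM K n ^ k, ∀ y : locCoh K (monIdeal K G) i, x • y = 0 := by
  intro i hi x hx y
  have : IsNoetherian (MvPolynomial (Fin n) K) (locCoh K (monIdeal K G) i) :=
    (isFiniteLength_iff_isNoetherian_isArtinian.1 (hgcm i hi)).1
  have h : idealM K n ^ k ≤ Module.annihilator _ (locCoh K (monIdeal K G) i) :=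
    idealM_pow_le_of_X_pow_rho_mem G hk fun j ↦
      Module.mem_annihilator.2 (X_pow_rho_smul_eq_zero G j)
  exact Module.mem_annihilator.1 (h hx) y

end GH
end

section
/- Let J ⊂ S = K[X_1,…,X_n] be a square-free monomial ideal such that S/J is Buchsbaum, so that H^i_m(S/J) is a finite-dimensional K-vector space (a direct sum of copies of S/m) for each i ≠ dim S/J, and assume H^i_m(S/J) ≠ 0 for some i ≠ dim S/J. Let a = (a_1,…,a_n) with each a_i ≥ 1 and let φ: S → S be the K-algebra map X_i ↦ X_i^{a_i}. Then for each i ≠ dim S/J, H^i_m(S/φ(J)S) is a direct sum of copies of S/(X_1^{a_1},…,X_n^{a_n}), and S/φ(J)S is strict k-Buchsbaum with k = Σ_{j=1}^n a_j − n + 1, i.e., m^k H^i_m(S/φ(J)S) = 0 for all i ≠ dim S/φ(J)S but m^{k−1} H^i_m(S/φ(J)S) ≠ 0 for some such i. -/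
/-!
Formalization of results from "Combinatorial characterizations of generalized
Cohen-Macaulay monomial ideals" (Y. Takayama).

Setting: `K` a field, `S = K[X_1, …, X_n]` realized as `MvPolynomial (Fin n) K`,
`I ⊆ S` a monomial ideal whose minimal monomial generators have the exponent
vectors in `G : Finset (Fin n →₀ ℕ)`.
-/

set_option maxHeartbeats 1000000
set_option synthInstance.maxHeartbeats 400000

open Finset MvPolynomial

namespace GH

variable (K : Type) [Field K]

universe u

noncomputable section BaseChange

open CategoryTheory Limits TensorProduct

variable (R S : Type u) [CommRing R] [CommRing S] [Algebra R S]

/-- The base change functor `M ↦ S ⊗[R] M`. -/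
def baseChangeFunctor : ModuleCat.{u} R ⥤ ModuleCat.{u} S where
  obj M := ModuleCat.of S (S ⊗[R] M)
  map f := ModuleCat.ofHom (f.hom.baseChange S)
  map_id M := by ext : 1; simp
  map_comp f g := by ext : 1; simp [LinearMap.baseChange_comp]

instance : (baseChangeFunctor R S).Additive where
  map_add {M N f g} := by
    ext : 1
    exact LinearMap.baseChange_add f.hom g.hom

/-- Linear maps out of `S ⊗[R] M` are linear maps out of `M`. -/
def baseChangeHomEquivAux (M N : Type u) [AddCommGroup M] [Module R M] [AddCommGroup N]
    [Module S N] [Module R N] (h : ∀ (r : R) (x : N), algebraMap R S r • x = r • x) :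
    (ModuleCat.of S (S ⊗[R] M) ⟶ ModuleCat.of S N) ≃ (ModuleCat.of R M ⟶ ModuleCat.of R N) :=
  haveI : IsScalarTower R S N := IsScalarTower.of_algebraMap_smul h
  (ModuleCat.homEquiv (M := ModuleCat.of S (S ⊗[R] M)) (N := ModuleCat.of S N)).trans
    ((LinearMap.liftBaseChangeEquiv (M := M) (N := N) S).symm.toEquiv.trans
      (ModuleCat.homEquiv (M := ModuleCat.of R M) (N := ModuleCat.of R N)).symm)

/-- The hom-set bijection between base change and restriction of scalars. -/
def baseChangeHomEquiv (M : ModuleCat.{u} R) (N : ModuleCat.{u} S) :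
    ((baseChangeFunctor R S).obj M ⟶ N) ≃
      (M ⟶ (ModuleCat.restrictScalars (algebraMap R S)).obj N) :=
  baseChangeHomEquivAux R S M ((ModuleCat.restrictScalars (algebraMap R S)).obj N) fun _ _ => rfl

lemma baseChangeFunctor_hom_ext {M : ModuleCat.{u} R} {N : ModuleCat.{u} S}
    {f g : (baseChangeFunctor R S).obj M ⟶ N}
    (h : ∀ m : M, f.hom ((1 : S) ⊗ₜ[R] m) = g.hom ((1 : S) ⊗ₜ[R] m)) : f = g := by
  apply (baseChangeHomEquiv R S M N).injective
  ext m
  exact h m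

/-- Base change is left adjoint to restriction of scalars. -/
def baseChangeAdjunction : baseChangeFunctor R S ⊣ ModuleCat.restrictScalars.{u} (algebraMap R S) :=
  Adjunction.mkOfHomEquiv {
    homEquiv := baseChangeHomEquiv R S
    homEquiv_naturality_left_symm := fun {M' M N} f g => by
      apply (baseChangeHomEquiv R S _ _).injective
      rw [Equiv.apply_symm_apply]
      ext x
      change _ = ((baseChangeHomEquiv R S M N).symm g).hom (1 ⊗ₜ f.hom x)
      change _ = (baseChangeHomEquiv R S M N ((baseChangeHomEquiv R S M N).symm g)).hom (f.hom x)
      rw [Equiv.apply_symm_apply]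
      rfl
    homEquiv_naturality_right := fun f g => rfl }

instance : (baseChangeFunctor R S).IsLeftAdjoint := (baseChangeAdjunction R S).isLeftAdjoint

lemma baseChangeFunctor_map_exact [Module.Flat R S] (T : ShortComplex (ModuleCat.{u} R))
    (h : T.Exact) :
    (T.map (baseChangeFunctor R S)).Exact := by
  rw [CategoryTheory.ShortComplex.ShortExact.moduleCat_exact_iff_function_exact] at h ⊢
  exact Module.Flat.lTensor_exact S h

instance [Module.Flat R S] : PreservesFiniteLimits (baseChangeFunctor R S) := by
  have := ((baseChangeFunctor R S).exact_tfae.out 1 3).mp (baseChangeFunctor_map_exact R S)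
  exact this.1

instance [Module.Flat R S] : PreservesFiniteColimits (baseChangeFunctor R S) := by
  have := ((baseChangeFunctor R S).exact_tfae.out 1 3).mp (baseChangeFunctor_map_exact R S)
  exact this.2

instance : (baseChangeFunctor R S).PreservesProjectiveObjects where
  projective_obj {P} hP := by
    have := (IsProjective.iff_projective P).mpr hP
    exact (IsProjective.iff_projective (S ⊗[R] P)).mp inferInstance

instance [Module.Flat R S] : PreservesFiniteLimits (baseChangeFunctor R S).op :=
  preservesFiniteLimits_op _
instance [Module.Flat R S] : PreservesFiniteColimits (baseChangeFunctor R S).op :=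
  preservesFiniteColimits_op _

section HomBaseChange
variable [Module.Free R S] [Module.Finite R S]
variable (M N : Type*) [AddCommGroup M] [Module R M] [AddCommGroup N] [Module R N]

lemma liftBaseChange_baseChangeHom_bijective : Function.Bijective
    (LinearMap.liftBaseChange S (LinearMap.baseChangeHom R S M N)) := by
  classical
  let b := Module.Free.chooseBasis R S
  have key (z : S ⊗[R] (M →ₗ[R] N)) (m : M) (i : Module.Free.ChooseBasisIndex R S) :
      TensorProduct.equivFinsuppOfBasisLeft b
        (LinearMap.liftBaseChange S (LinearMap.baseChangeHom R S M N) z (1 ⊗ₜ m)) i =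
      TensorProduct.equivFinsuppOfBasisLeft b z i m := by
    induction z using TensorProduct.induction_on with
    | zero => simp
    | add x y hx hy => simp [hx, hy]
    | tmul s g => simp [TensorProduct.smul_tmul']
  constructor
  · rw [injective_iff_map_eq_zero]
    intro z hz
    apply (TensorProduct.equivFinsuppOfBasisLeft b).injective
    ext i m
    rw [← key, hz]
    simp
  · intro G
    let c (i : Module.Free.ChooseBasisIndex R S) : M →ₗ[R] N := Finsupp.lapply i ∘ₗ
      (TensorProduct.equivFinsuppOfBasisLeft b).toLinearMap ∘ₗ G.restrictScalars R ∘ₗ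
        TensorProduct.mk R S M 1
    refine ⟨(TensorProduct.equivFinsuppOfBasisLeft b).symm
      (Finsupp.equivFunOnFinite.symm c), ?_⟩
    ext m
    apply (TensorProduct.equivFinsuppOfBasisLeft b).injective
    ext i
    simp only [TensorProduct.AlgebraTensorModule.curry_apply,
      TensorProduct.curry_apply, LinearMap.coe_restrictScalars]
    rw [key, LinearEquiv.apply_symm_apply]
    rfl

/-- Base change commutes with `Hom` along a finite free algebra. -/
def homBaseChangeEquiv : S ⊗[R] (M →ₗ[R] N) ≃ₗ[S] (S ⊗[R] M →ₗ[S] S ⊗[R] N) :=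
  LinearEquiv.ofBijective _ (liftBaseChange_baseChangeHom_bijective R S M N)

lemma homBaseChangeEquiv_tmul (s : S) (g : M →ₗ[R] N) :
    homBaseChangeEquiv R S M N (s ⊗ₜ g) = s • g.baseChange S := by
  simp [homBaseChangeEquiv]

end HomBaseChange

section
variable [Module.Free R S] [Module.Finite R S]

/-- Base change commutes with `Hom` along a finite free algebra, in `ModuleCat S`. -/
def homBaseChangeIso (P M : ModuleCat.{u} R) :
    (baseChangeFunctor R S).obj (ModuleCat.of R (P ⟶ M)) ≅
      ModuleCat.of S ((baseChangeFunctor R S).obj P ⟶ (baseChangeFunctor R S).obj M) :=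
  (baseChangeFunctor R S).mapIso (ModuleCat.homLinearEquiv (S := R) (M := P) (N := M)).toModuleIso
    ≪≫ (homBaseChangeEquiv R S P M).toModuleIso ≪≫
    (ModuleCat.homLinearEquiv (S := S) (M := (baseChangeFunctor R S).obj P)
      (N := (baseChangeFunctor R S).obj M)).symm.toModuleIso

lemma homBaseChangeIso_hom_tmul (P M : ModuleCat.{u} R) (s : S) (g : P ⟶ M) :
    (homBaseChangeIso R S P M).hom.hom (s ⊗ₜ g) = s • (baseChangeFunctor R S).map g := by
  ext : 1
  exact homBaseChangeEquiv_tmul R S P M s g.hom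

lemma homBaseChangeIso_naturality {P Q : ModuleCat.{u} R} (M : ModuleCat.{u} R) (f : P ⟶ Q) :
    (baseChangeFunctor R S).map (ModuleCat.ofHom (Linear.leftComp R M f)) ≫
        (homBaseChangeIso R S P M).hom =
      (homBaseChangeIso R S Q M).hom ≫ ModuleCat.ofHom
        (Linear.leftComp S ((baseChangeFunctor R S).obj M) ((baseChangeFunctor R S).map f)) := by
  apply baseChangeFunctor_hom_ext
  intro (g : Q ⟶ M)
  change (homBaseChangeIso R S P M).hom.hom (1 ⊗ₜ (f ≫ g)) =
    (baseChangeFunctor R S).map f ≫ (homBaseChangeIso R S Q M).hom.hom (1 ⊗ₜ g)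
  rw [homBaseChangeIso_hom_tmul, homBaseChangeIso_hom_tmul, Functor.map_comp, Linear.comp_smul]

/-- The isomorphisms `homBaseChangeIso` are natural in the contravariant variable. -/
def homBaseChangeNatIso (M : ModuleCat.{u} R) :
    ((linearYoneda R (ModuleCat R)).obj M).rightOp ⋙ (baseChangeFunctor R S).op ≅
    baseChangeFunctor R S ⋙
      ((linearYoneda S (ModuleCat S)).obj ((baseChangeFunctor R S).obj M)).rightOp :=
  NatIso.ofComponents (fun P => (homBaseChangeIso R S P M).symm.op) (by
    intro P Q f
    apply Quiver.Hom.unop_inj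
    have h := homBaseChangeIso_naturality R S M f
    rw [← Iso.eq_comp_inv, Category.assoc, ← Iso.inv_comp_eq] at h
    exact h)

end

section Derived

lemma comp_comm_of_squares {A : Type*} [Category* A] {X₀ X₁ X₂ X₃ X₄ Y₀ Y₁ Y₂ Y₃ Y₄ : A}
    {a₁ : X₀ ⟶ X₁} {a₂ : X₁ ⟶ X₂} {a₃ : X₂ ⟶ X₃} {a₄ : X₃ ⟶ X₄}
    {b₁ : Y₀ ⟶ Y₁} {b₂ : Y₁ ⟶ Y₂} {b₃ : Y₂ ⟶ Y₃} {b₄ : Y₃ ⟶ Y₄}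
    {f₀ : X₀ ⟶ Y₀} {f₁ : X₁ ⟶ Y₁} {f₂ : X₂ ⟶ Y₂} {f₃ : X₃ ⟶ Y₃} {f₄ : X₄ ⟶ Y₄}
    (h₁ : f₀ ≫ b₁ = a₁ ≫ f₁) (h₂ : f₁ ≫ b₂ = a₂ ≫ f₂) (h₃ : f₂ ≫ b₃ = a₃ ≫ f₃)
    (h₄ : f₃ ≫ b₄ = a₄ ≫ f₄) :
    f₀ ≫ b₁ ≫ b₂ ≫ b₃ ≫ b₄ = (a₁ ≫ a₂ ≫ a₃ ≫ a₄) ≫ f₄ := by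
  simp only [Category.assoc, ← h₄, ← reassoc_of% h₃, ← reassoc_of% h₂, ← reassoc_of% h₁]

variable {C C' D D' : Type*} [Category* C] [Category* C'] [Category* D] [Category* D']
  [Abelian C] [Abelian C'] [Abelian D] [Abelian D']

/-- An exact functor commutes with homology. -/
def homologyMapIso (E : D ⥤ D') [E.Additive] [E.PreservesHomology] (n : ℕ) (K : ChainComplex D ℕ) :
    (HomologicalComplex.homologyFunctor D' _ n).obj ((E.mapHomologicalComplex _).obj K) ≅
    E.obj ((HomologicalComplex.homologyFunctor D _ n).obj K) :=
  (K.sc n).mapHomologyIso E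

lemma homologyMapIso_naturality (E : D ⥤ D') [E.Additive] [E.PreservesHomology] (n : ℕ)
   {K L : ChainComplex D ℕ} (f : K ⟶ L) :
   (HomologicalComplex.homologyFunctor D' _ n).map ((E.mapHomologicalComplex _).map f) ≫
     (homologyMapIso E n L).hom =
   (homologyMapIso E n K).hom ≫ E.map ((HomologicalComplex.homologyFunctor D _ n).map f) :=
  ShortComplex.mapHomologyIso_hom_naturality
    ((HomologicalComplex.shortComplexFunctor D _ n).map f) E

lemma mapProjectiveResolution_π_f_zero (B : C ⥤ C') [B.Additive] [B.PreservesHomology]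
    [B.PreservesProjectiveObjects] {X : C} (P : ProjectiveResolution X) :
    (B.mapProjectiveResolution P).π.f 0 = B.map (P.π.f 0) := by
  change B.map (P.π.f 0) ≫
    ((HomologicalComplex.singleMapHomologicalComplex B (ComplexShape.down ℕ) 0).hom.app X).f 0 = _
  rw [HomologicalComplex.singleMapHomologicalComplex_hom_app_self]
  have h (f : B.obj (P.complex.X 0) ⟶ B.obj X) : f ≫ B.map (𝟙 X) ≫ 𝟙 (B.obj X) = f := by simp
  exact h (B.map (P.π.f 0))

variable [HasProjectiveResolutions C] [HasProjectiveResolutions C']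
  {B : C ⥤ C'} {T : C ⥤ D} {T' : C' ⥤ D'} {E : D ⥤ D'}
  [B.Additive] [T.Additive] [T'.Additive] [E.Additive] [E.PreservesHomology] [B.PreservesHomology]
  [B.PreservesProjectiveObjects] (α : T ⋙ E ≅ B ⋙ T') (n : ℕ)

/-- An exact functor intertwining `T` and `T'` intertwines their left derived functors. -/
def leftDerivedObjIso (X : C) :
    E.obj ((T.leftDerived n).obj X) ≅ (T'.leftDerived n).obj (B.obj X) :=
  E.mapIso ((projectiveResolution X).isoLeftDerivedObj T n) ≪≫
    (homologyMapIso E n _).symm ≪≫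
    (HomologicalComplex.homologyFunctor D' _ n).mapIso
      ((NatIso.mapHomologicalComplex α (ComplexShape.down ℕ)).app _) ≪≫
    ((B.mapProjectiveResolution (projectiveResolution X)).isoLeftDerivedObj T' n).symm

/-- The isomorphisms `leftDerivedObjIso` are natural. -/
def leftDerivedNatIso : T.leftDerived n ⋙ E ≅ B ⋙ T'.leftDerived n :=
  NatIso.ofComponents (leftDerivedObjIso α n) (by
    intro X Y f
    let P := projectiveResolution X
    let Q := projectiveResolution Y
    let φ := ProjectiveResolution.lift f P Q
    have hφ := ProjectiveResolution.lift_commutes_zero f P Q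
    have h1 := ProjectiveResolution.isoLeftDerivedObj_hom_naturality f P Q φ hφ T n
    have h4 := ProjectiveResolution.isoLeftDerivedObj_inv_naturality (B.map f)
      (B.mapProjectiveResolution P) (B.mapProjectiveResolution Q)
      ((B.mapHomologicalComplex _).map φ)
      (by
        rw [mapProjectiveResolution_π_f_zero, mapProjectiveResolution_π_f_zero]
        exact (B.map_comp (φ.f 0) (Q.π.f 0)).symm.trans
          ((congrArg B.map hφ).trans (B.map_comp (P.π.f 0) f))) T' n
    have h2 := homologyMapIso_naturality E n ((T.mapHomologicalComplex _).map φ)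
    have h3 := (NatIso.mapHomologicalComplex α (ComplexShape.down ℕ)).hom.naturality φ
    rw [← Iso.inv_comp_eq, ← Category.assoc, ← Iso.eq_comp_inv] at h2
    have h3' := congrArg (HomologicalComplex.homologyFunctor D' _ n).map h3
    rw [Functor.map_comp, Functor.map_comp] at h3'
    have h1' := congrArg E.map h1
    rw [Functor.map_comp, Functor.map_comp] at h1'
    exact comp_comm_of_squares h1' h2.symm h3' h4.symm)
end Derived

section
variable [Module.Free R S] [Module.Finite R S]

/-- `Ext` commutes with base change along a finite free algebra. -/
def extBaseChangeIso (M : ModuleCat.{u} R) (n : ℕ) :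
    (Ext R (ModuleCat.{u} R) n).flip.obj M ⋙ baseChangeFunctor R S ≅
      (baseChangeFunctor R S).op ⋙
        (Ext S (ModuleCat.{u} S) n).flip.obj ((baseChangeFunctor R S).obj M) :=
  NatIso.ofComponents
    (fun N => ((leftDerivedNatIso (homBaseChangeNatIso R S M) n).app N.unop).unop.symm) (by
      intro X Y f
      have h := congrArg Quiver.Hom.unop
        ((leftDerivedNatIso (homBaseChangeNatIso R S M) n).inv.naturality f.unop)
      exact h.symm)

/-- The base change of `R ⧸ I` is `S ⧸ IS`. -/
def quotientBaseChangeIso (I : Ideal R) :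
    (baseChangeFunctor R S).obj (ModuleCat.of R (R ⧸ I)) ≅
      ModuleCat.of S (S ⧸ I.map (algebraMap R S)) :=
  (Algebra.TensorProduct.quotIdealMapEquivTensorQuot S I).symm.toLinearEquiv.toModuleIso

/-- The base change of the system `R ⧸ I ^ t` is the system `S ⧸ (IS) ^ t`. -/
def ringModIdealsBaseChangeIso (I : Ideal R) :
    localCohomology.ringModIdeals (localCohomology.idealPowersDiagram I) ⋙ baseChangeFunctor R S ≅
      localCohomology.ringModIdeals
        (localCohomology.idealPowersDiagram (I.map (algebraMap R S))) :=
  NatIso.ofComponents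
    (fun t => quotientBaseChangeIso R S (I ^ t.unop) ≪≫
      (Submodule.quotEquivOfEq _ _ (Ideal.map_pow (algebraMap R S) I t.unop)).toModuleIso) (by
    intro X Y f
    apply baseChangeFunctor_hom_ext
    intro x
    obtain ⟨r, rfl⟩ := Ideal.Quotient.mk_surjective x
    rfl)

/-- Local cohomology commutes with base change along a finite free algebra. -/
def localCohomologyBaseChangeIso (I : Ideal R) (i : ℕ) (M : ModuleCat.{u} R) :
    (baseChangeFunctor R S).obj ((localCohomology I i).obj M) ≅
      (localCohomology (I.map (algebraMap R S)) i).obj ((baseChangeFunctor R S).obj M) :=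
  (baseChangeFunctor R S).mapIso (colimitObjIsoColimitCompEvaluation
    (localCohomology.diagram (localCohomology.idealPowersDiagram I) i) M) ≪≫
  preservesColimitIso (baseChangeFunctor R S) _ ≪≫
  HasColimit.isoOfNatIso
    (Functor.isoWhiskerLeft
      (localCohomology.ringModIdeals (localCohomology.idealPowersDiagram I)).op
      (extBaseChangeIso R S M i) ≪≫
      Functor.isoWhiskerRight (NatIso.op (ringModIdealsBaseChangeIso R S I)).symm
        ((Ext S (ModuleCat.{u} S) i).flip.obj ((baseChangeFunctor R S).obj M))) ≪≫
  (colimitObjIsoColimitCompEvaluation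
    (localCohomology.diagram (localCohomology.idealPowersDiagram (I.map (algebraMap R S))) i)
    ((baseChangeFunctor R S).obj M)).symm

/-- The base change of `H^i_I(R ⧸ J)` is `H^i_{IS}(S ⧸ JS)`. -/
def localCohomologyQuotientBaseChangeIso (I J : Ideal R) (i : ℕ) :
    (baseChangeFunctor R S).obj ((localCohomology I i).obj (ModuleCat.of R (R ⧸ J))) ≅
      (localCohomology (I.map (algebraMap R S)) i).obj
        (ModuleCat.of S (S ⧸ J.map (algebraMap R S))) :=
  localCohomologyBaseChangeIso R S I i _ ≪≫
    (localCohomology (I.map (algebraMap R S)) i).mapIso (quotientBaseChangeIso R S J)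

end

section RingHom
variable {R S : Type u} [CommRing R] [CommRing S]

theorem nonempty_localCohomology_map_equiv_finsupp (f : R →+* S) {β : Type*} [Finite β] (b : β → S)
    (hb : Function.Bijective fun r : β →₀ R => r.sum fun i x => f x * b i)
    (I J P : Ideal R) (i : ℕ) {ι : Type*}
    (e : (localCohomology I i).obj (ModuleCat.of R (R ⧸ J)) ≃ₗ[R] (ι →₀ R ⧸ P)) :
    Nonempty ((localCohomology (I.map f) i).obj (ModuleCat.of S (S ⧸ J.map f)) ≃ₗ[S]
      (ι →₀ S ⧸ P.map f)) := by
  classical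
  algebraize [f]
  have hb' : Function.Bijective (Finsupp.linearCombination R b) := by
    convert hb using 2 with r
    simp only [Finsupp.linearCombination_apply, Algebra.smul_def]
    rfl
  let B : Module.Basis β R S := .ofRepr (LinearEquiv.ofBijective _ hb').symm
  have := Module.Free.of_basis B
  have := Module.Finite.of_basis B
  exact ⟨(localCohomologyQuotientBaseChangeIso R S I J i).symm.toLinearEquiv ≪≫ₗ
    LinearEquiv.baseChange R S _ _ e ≪≫ₗ
    TensorProduct.finsuppRight R S S (R ⧸ P) ι ≪≫ₗ
    Finsupp.mapRange.linearEquiv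
      (Algebra.TensorProduct.quotIdealMapEquivTensorQuot S P).symm.toLinearEquiv⟩

end RingHom

end BaseChange

/-- Division with remainder of exponent vectors by `a`. -/
noncomputable def divModEquiv {n : ℕ} (a : Fin n → ℕ) (ha : ∀ i, 1 ≤ a i) :
    (Σ _ : (∀ j, Fin (a j)), Fin n →₀ ℕ) ≃ (Fin n →₀ ℕ) where
  toFun p := Finsupp.equivFunOnFinite.symm fun j => a j * p.2 j + p.1 j
  invFun u := ⟨fun j => ⟨u j % a j, Nat.mod_lt _ (ha j)⟩,
    Finsupp.equivFunOnFinite.symm fun j => u j / a j⟩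
  left_inv p := by
    obtain ⟨c, d⟩ := p
    have h (j : Fin n) : (a j * d j + c j) % a j = c j := by
      rw [Nat.mul_add_mod, Nat.mod_eq_of_lt (c j).2]
    have h' (j : Fin n) : (a j * d j + c j) / a j = d j := by
      rw [Nat.mul_add_div (ha j), Nat.div_eq_of_lt (c j).2, add_zero]
    simp [h, h']
  right_inv u := by
    ext j
    simp [Nat.div_add_mod]

lemma aeval_X_pow_monomial {n : ℕ} (a : Fin n → ℕ) (d : Fin n →₀ ℕ) :
    aeval (fun i => (X i : MvPolynomial (Fin n) K) ^ a i) (monomial d (1 : K)) =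
      monomial (Finsupp.equivFunOnFinite.symm fun j => a j * d j) 1 := by
  rw [aeval_monomial, monomial_eq, Finsupp.prod_fintype _ _ (by simp),
    Finsupp.prod_fintype _ _ (by simp)]
  simp [pow_mul]

lemma bijective_sum_aeval_X_pow {n : ℕ} (a : Fin n → ℕ) (ha : ∀ i, 1 ≤ a i) :
    Function.Bijective fun r : (∀ j, Fin (a j)) →₀ MvPolynomial (Fin n) K =>
      r.sum fun c x => (aeval fun i => (X i : MvPolynomial (Fin n) K) ^ a i).toRingHom x *
        monomial (Finsupp.equivFunOnFinite.symm fun j => (c j : ℕ)) (1 : K) := by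
  classical
  let b := Finsupp.basis fun _ : (∀ j, Fin (a j)) => basisMonomials (Fin n) K
  let e := b.equiv (basisMonomials (Fin n) K) (divModEquiv a ha)
  let L : ((∀ j, Fin (a j)) →₀ MvPolynomial (Fin n) K) →ₗ[K] MvPolynomial (Fin n) K :=
    Finsupp.lsum K fun c =>
      LinearMap.mulRight K
        (monomial (Finsupp.equivFunOnFinite.symm fun j => (c j : ℕ)) (1 : K)) ∘ₗ
        (aeval fun i => (X i : MvPolynomial (Fin n) K) ^ a i).toLinearMap
  have h : L = e.toLinearMap := by
    refine b.ext fun ⟨c, d⟩ => ?_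
    have he : e (b ⟨c, d⟩) = monomial (divModEquiv a ha ⟨c, d⟩) 1 := by
      rw [Module.Basis.equiv_apply, coe_basisMonomials]
    rw [LinearEquiv.coe_coe, he]
    simp only [L, b, Finsupp.coe_basis, coe_basisMonomials, Finsupp.lsum_single,
      LinearMap.comp_apply, AlgHom.toLinearMap_apply, aeval_X_pow_monomial,
      LinearMap.mulRight_apply, monomial_mul, mul_one]
    refine congrArg (fun d => monomial d 1) ?_
    ext j
    simp [divModEquiv]
  have h' := e.bijective
  rw [← LinearEquiv.coe_coe, ← h] at h'
  exact h'

section Powers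
variable {n : ℕ} (a : Fin n → ℕ)

lemma idealOfVars_map_aeval_X_pow :
    (idealOfVars (Fin n) K).map (aeval (fun i => (X i : MvPolynomial (Fin n) K) ^ a i) :
        MvPolynomial (Fin n) K →ₐ[K] MvPolynomial (Fin n) K).toRingHom =
      Ideal.span (Set.range fun j => (X j : MvPolynomial (Fin n) K) ^ a j) := by
  rw [Ideal.map_span, ← Set.range_comp]
  congr 2
  ext1 j
  simp

lemma mem_span_range_X_pow_iff {x : MvPolynomial (Fin n) K} :
    x ∈ Ideal.span (Set.range fun j => (X j : MvPolynomial (Fin n) K) ^ a j) ↔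
      ∀ u ∈ x.support, ∃ j, a j ≤ u j := by
  have h : (Set.range fun j => (X j : MvPolynomial (Fin n) K) ^ a j) =
      (fun u => monomial u (1 : K)) '' Set.range fun j => Finsupp.single j (a j) := by
    rw [← Set.range_comp]
    congr 1
    ext1 j
    simp [X_pow_eq_monomial]
  rw [h, mem_ideal_span_monomial_image]
  simp

lemma isMaximal_idealOfVars : (idealOfVars (Fin n) K).IsMaximal := by
  have h : idealOfVars (Fin n) K = RingHom.ker (constantCoeff (σ := Fin n) (R := K)) := by
    ext x
    rw [← pow_one (idealOfVars (Fin n) K), mem_pow_idealOfVars_iff', RingHom.mem_ker,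
      constantCoeff_eq]
    refine ⟨fun h => h 0 (by simp), fun h u hu => ?_⟩
    rw [Nat.lt_one_iff, Finsupp.degree_eq_zero_iff] at hu
    rwa [hu]
  rw [h]
  exact RingHom.ker_isMaximal_of_surjective _ fun c => ⟨C c, constantCoeff_C (Fin n) c⟩

variable {a}

lemma radical_span_range_X_pow (ha : ∀ i, 1 ≤ a i) :
    (Ideal.span (Set.range fun j => (X j : MvPolynomial (Fin n) K) ^ a j)).radical =
      (idealOfVars (Fin n) K).radical := by
  apply le_antisymm
  · apply Ideal.radical_mono
    rw [Ideal.span_le]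
    rintro _ ⟨j, rfl⟩
    exact Ideal.pow_mem_of_mem _ (Ideal.subset_span (Set.mem_range_self j)) _ (ha j)
  · rw [Ideal.radical_le_radical_iff, Ideal.span_le]
    rintro _ ⟨j, rfl⟩
    exact ⟨a j, Ideal.subset_span (Set.mem_range_self j)⟩

lemma sum_tsub_one (ha : ∀ i, 1 ≤ a i) : ∑ j, (a j - 1) = (∑ j, a j) - n := by
  rw [Finset.sum_tsub_distrib _ fun j _ => ha j]
  simp

lemma pow_idealOfVars_le_span_range_X_pow (ha : ∀ i, 1 ≤ a i) :
    idealOfVars (Fin n) K ^ ((∑ j, a j) - n + 1) ≤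
      Ideal.span (Set.range fun j => (X j : MvPolynomial (Fin n) K) ^ a j) := by
  intro x hx
  rw [mem_pow_idealOfVars_iff] at hx
  rw [mem_span_range_X_pow_iff]
  intro u hu
  by_contra! h
  have h1 : u.degree ≤ ∑ j, (a j - 1) := by
    rw [Finsupp.degree_eq_sum]
    exact Finset.sum_le_sum fun j _ => Nat.le_sub_one_of_lt (h j)
  rw [sum_tsub_one ha] at h1
  have := hx u hu
  omega

lemma exists_mem_pow_idealOfVars_notMem_span_range_X_pow (ha : ∀ i, 1 ≤ a i) :
    ∃ x ∈ idealOfVars (Fin n) K ^ ((∑ j, a j) - n),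
      x ∉ Ideal.span (Set.range fun j => (X j : MvPolynomial (Fin n) K) ^ a j) := by
  refine ⟨monomial (Finsupp.equivFunOnFinite.symm fun j => a j - 1) 1, ?_, ?_⟩
  · rw [monomial_mem_pow_idealOfVars_iff _ _ one_ne_zero, Finsupp.degree_eq_sum,
      ← sum_tsub_one ha]
    rfl
  · rw [mem_span_range_X_pow_iff]
    intro h
    obtain ⟨j, hj⟩ := h (Finsupp.equivFunOnFinite.symm fun j => a j - 1) (by simp)
    have := ha j
    change a j ≤ a j - 1 at hj
    omega

lemma radical_map_aeval_X_pow (ha : ∀ i, 1 ≤ a i) (s : Set (Fin n →₀ ℕ)) :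
    ((Ideal.span ((fun u => monomial u (1 : K)) '' s)).map
      (aeval (fun i => (X i : MvPolynomial (Fin n) K) ^ a i) :
        MvPolynomial (Fin n) K →ₐ[K] MvPolynomial (Fin n) K)).radical =
      (Ideal.span ((fun u => monomial u (1 : K)) '' s)).radical := by
  have hd {u v : Fin n →₀ ℕ} (h : u ≤ v) : monomial u (1 : K) ∣ monomial v 1 := by
    rw [monomial_dvd_monomial]
    exact ⟨.inr h, one_dvd _⟩
  apply le_antisymm
  · apply Ideal.radical_mono
    rw [Ideal.map_span, Ideal.span_le]
    rintro _ ⟨_, ⟨u, hu, rfl⟩, rfl⟩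
    refine Ideal.mem_of_dvd _ ?_ (Ideal.subset_span ⟨u, hu, rfl⟩)
    rw [aeval_X_pow_monomial]
    exact hd fun j => Nat.le_mul_of_pos_left _ (ha j)
  · rw [Ideal.radical_le_radical_iff, Ideal.span_le]
    rintro _ ⟨u, hu, rfl⟩
    refine ⟨∑ j, a j, ?_⟩
    refine Ideal.mem_of_dvd _ ?_ (Ideal.mem_map_of_mem _ (Ideal.subset_span ⟨u, hu, rfl⟩))
    rw [aeval_X_pow_monomial, monomial_pow, one_pow]
    refine hd fun j => ?_
    simpa using Nat.mul_le_mul_right _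
      (Finset.single_le_sum (fun _ _ => Nat.zero_le _) (Finset.mem_univ j))

end Powers

lemma ringKrullDim_quotient_eq_of_radical_eq {R : Type*} [CommRing R] {I J : Ideal R}
    (h : I.radical = J.radical) : ringKrullDim (R ⧸ I) = ringKrullDim (R ⧸ J) := by
  rw [ringKrullDim_quotient, ringKrullDim_quotient, ← PrimeSpectrum.zeroLocus_radical I, h,
    PrimeSpectrum.zeroLocus_radical]

lemma exists_nonempty_equiv_finsupp_quotient_of_isMaximal {R M : Type*} [CommRing R]
    [AddCommGroup M] [Module R M] (P : Ideal R) [P.IsMaximal]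
    (h : ∀ x ∈ P, ∀ y : M, x • y = 0) :
    ∃ (s : Set M), Nonempty (M ≃ₗ[R] (s →₀ R ⧸ P)) := by
  have hM : Module.IsTorsionBySet R M P := fun y x => h x x.2 y
  let _ := Ideal.Quotient.field P
  let _ := hM.module
  exact ⟨_, ⟨(Module.Basis.ofVectorSpace (R ⧸ P) M).repr.restrictScalars R⟩⟩

lemma smul_finsupp_quotient_eq_zero {R ι : Type*} [CommRing R] {P : Ideal R} {x : R} (hx : x ∈ P)
    (y : ι →₀ R ⧸ P) : x • y = 0 := by
  ext c
  rw [Finsupp.smul_apply, Algebra.smul_def, Ideal.Quotient.algebraMap_eq,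
    Ideal.Quotient.eq_zero_iff_mem.mpr hx, zero_mul, Finsupp.zero_apply]

lemma mem_of_smul_one_quotient_eq_zero {R : Type*} [CommRing R] {P : Ideal R} {x : R}
    (h : x • (1 : R ⧸ P) = 0) : x ∈ P := by
  rwa [Algebra.smul_def, mul_one, Ideal.Quotient.algebraMap_eq,
    Ideal.Quotient.eq_zero_iff_mem] at h

/-- **Example 1.6.** Let `J ⊆ S` be a square-free monomial ideal such
that `S/J` is Buchsbaum — so each `H^i_𝔪(S/J)` with `i ≠ dim S/J` is a finite
dimensional `K`-vector space (a finite length `S`-module annihilated by `𝔪`) — and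
assume `H^i_𝔪(S/J) ≠ 0` for some `i ≠ dim S/J`. Let `a = (a_1, …, a_n)` with all
`a_i ≥ 1` and `φ : S → S` the `K`-algebra map `X_i ↦ X_i^{a_i}`. Then for each
`i ≠ dim S/φ(J)S`, the module `H^i_𝔪(S/φ(J)S)` is a direct sum of copies of
`S/(X_1^{a_1}, …, X_n^{a_n})`, and `S/φ(J)S` is strict `k`-Buchsbaum with
`k = Σ_{j=1}^n a_j - n + 1`: `𝔪^k H^i_𝔪(S/φ(J)S) = 0` for all `i ≠ dim S/φ(J)S`, but
`𝔪^{k-1} H^i_𝔪(S/φ(J)S) ≠ 0` for some such `i`. -/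
theorem frobenius_image_strict_k_Buchsbaum {n : ℕ} (G : Finset (Expo n))
    (hG : MinGens G) (hsq : ∀ u ∈ G, ∀ j, u j ≤ 1)
    (hBbm : ∀ i : ℕ,
      (i : WithBot (WithTop ℕ)) ≠ ringKrullDim (MvPolynomial (Fin n) K ⧸ monIdeal K G) →
      IsFiniteLength (MvPolynomial (Fin n) K) (locCoh K (monIdeal K G) i) ∧
        ∀ x ∈ idealM K n, ∀ y : locCoh K (monIdeal K G) i, x • y = 0)
    (hnz : ∃ i : ℕ,
      (i : WithBot (WithTop ℕ)) ≠ ringKrullDim (MvPolynomial (Fin n) K ⧸ monIdeal K G) ∧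
      Nontrivial (locCoh K (monIdeal K G) i))
    (a : Fin n → ℕ) (ha : ∀ i, 1 ≤ a i) (k : ℕ) (hk : k = (∑ j, a j) - n + 1) :
    let Jφ : Ideal (MvPolynomial (Fin n) K) := (monIdeal K G).map
      (MvPolynomial.aeval (fun i => (X i : MvPolynomial (Fin n) K) ^ a i) :
        MvPolynomial (Fin n) K →ₐ[K] MvPolynomial (Fin n) K)
    (∀ i : ℕ,
      (i : WithBot (WithTop ℕ)) ≠ ringKrullDim (MvPolynomial (Fin n) K ⧸ Jφ) →
      ∃ ι : Type, Nonempty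
        ((locCoh K Jφ i : Type) ≃ₗ[MvPolynomial (Fin n) K]
          (ι →₀ (MvPolynomial (Fin n) K ⧸
            Ideal.span (Set.range fun j => (X j : MvPolynomial (Fin n) K) ^ a j))))) ∧
    (∀ i : ℕ,
      (i : WithBot (WithTop ℕ)) ≠ ringKrullDim (MvPolynomial (Fin n) K ⧸ Jφ) →
      ∀ x ∈ idealM K n ^ k, ∀ y : locCoh K Jφ i, x • y = 0) ∧
    (∃ i : ℕ,
      (i : WithBot (WithTop ℕ)) ≠ ringKrullDim (MvPolynomial (Fin n) K ⧸ Jφ) ∧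
      ∃ x ∈ idealM K n ^ (k - 1), ∃ y : locCoh K Jφ i, x • y ≠ 0) := by
  intro Jφ
  let φ : MvPolynomial (Fin n) K →ₐ[K] MvPolynomial (Fin n) K :=
    MvPolynomial.aeval (fun i => (X i : MvPolynomial (Fin n) K) ^ a i)
  have hdim : ringKrullDim (MvPolynomial (Fin n) K ⧸ Jφ) =
      ringKrullDim (MvPolynomial (Fin n) K ⧸ monIdeal K G) :=
    ringKrullDim_quotient_eq_of_radical_eq (radical_map_aeval_X_pow K ha _)
  have key (i : ℕ) (hi : (i : WithBot (WithTop ℕ)) ≠ ringKrullDim (MvPolynomial (Fin n) K ⧸ Jφ)) :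
      ∃ ι : Type, (Nontrivial (locCoh K (monIdeal K G) i) → Nonempty ι) ∧ Nonempty
        ((locCoh K Jφ i : Type) ≃ₗ[MvPolynomial (Fin n) K]
          (ι →₀ (MvPolynomial (Fin n) K ⧸
            Ideal.span (Set.range fun j => (X j : MvPolynomial (Fin n) K) ^ a j)))) := by
    have := isMaximal_idealOfVars (n := n) K
    obtain ⟨ι, ⟨e⟩⟩ := exists_nonempty_equiv_finsupp_quotient_of_isMaximal
      (idealOfVars (Fin n) K) (hBbm i (hdim ▸ hi)).2
    refine ⟨ι, fun h => ?_, ?_⟩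
    · by_contra hι
      rw [not_nonempty_iff] at hι
      exact not_subsingleton _ e.toEquiv.subsingleton
    · obtain ⟨e'⟩ := nonempty_localCohomology_map_equiv_finsupp φ.toRingHom _
        (bijective_sum_aeval_X_pow K a ha) (idealOfVars (Fin n) K) (monIdeal K G)
        (idealOfVars (Fin n) K) i e
      rw [idealOfVars_map_aeval_X_pow] at e'
      exact ⟨((localCohomology.isoOfSameRadical (radical_span_range_X_pow K ha) i).app
        (ModuleCat.of _ (MvPolynomial (Fin n) K ⧸ Jφ))).symm.toLinearEquiv ≪≫ₗ e'⟩
  refine ⟨fun i hi => ?_, fun i hi x hx y => ?_, ?_⟩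
  · obtain ⟨ι, -, e⟩ := key i hi
    exact ⟨ι, e⟩
  · obtain ⟨ι, -, ⟨e⟩⟩ := key i hi
    apply e.injective
    rw [map_smul, map_zero]
    subst hk
    exact smul_finsupp_quotient_eq_zero (pow_idealOfVars_le_span_range_X_pow K ha hx) _
  · obtain ⟨i, hi, hnt⟩ := hnz
    obtain ⟨ι, hι, ⟨e⟩⟩ := key i (hdim ▸ hi)
    obtain ⟨c⟩ := hι hnt
    obtain ⟨x, hx, hx'⟩ := exists_mem_pow_idealOfVars_notMem_span_range_X_pow K ha
    refine ⟨i, hdim ▸ hi, x, by rwa [hk, Nat.add_sub_cancel], e.symm (Finsupp.single c 1), ?_⟩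
    rw [← map_smul, Finsupp.smul_single]
    intro h
    rw [e.symm.map_eq_zero_iff, Finsupp.single_eq_zero] at h
    exact hx' (mem_of_smul_one_quotient_eq_zero h)

end GH
end

section
/- Let I ⊂ S = K[X_1,…,X_n] be a monomial ideal and i > 0. If H^i_m(S/I) has finite length, then for every (i−1)-face σ ∈ Δ and every a ∈ Z^n satisfying (a) 0 ≤ a ≤ ρ − 1, (b) L(a(σ), u) ≠ ∅ for all u ∈ G_0(I), and (c) a(σ) is maximal with properties (a) and (b) for the fixed σ, there exists ℓ ∈ [m] \ σ such that (i) a_ℓ = ρ_ℓ − 1, and (ii) for all u ∈ G_0(I) with ν_ℓ(u) = ρ_ℓ one has L(a(σ ∪ {ℓ}), u) ≠ ∅. -/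
/-!
Formalization of results from "Combinatorial characterizations of generalized
Cohen-Macaulay monomial ideals" (Y. Takayama).

Setting: `K` a field, `S = K[X_1, …, X_n]` realized as `MvPolynomial (Fin n) K`,
`I ⊆ S` a monomial ideal whose minimal monomial generators have the exponent
vectors in `G : Finset (Fin n →₀ ℕ)`.
-/

set_option maxHeartbeats 1000000
set_option synthInstance.maxHeartbeats 400000

open Finset MvPolynomial

namespace GH

variable (K : Type) [Field K]

/-- `G_0(I)`: the generators supported on at least two variables -/
def G0 {n : ℕ} (G : Finset (Expo n)) : Finset (Expo n) :=
  G.filter fun u => 2 ≤ u.support.card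

/-- `L(a, u) = {i ∈ [n] : ν_i(u) > a_i}` -/
def Lset {n : ℕ} (a : Fin n → ℤ) (u : Expo n) : Finset (Fin n) :=
  univ.filter fun i => a i < (u i : ℤ)

/-- `a(σ)`: the vector obtained from `a` by replacing the coordinates in `σ` by `ρ` -/
def asub {n : ℕ} (ρ : Fin n → ℕ) (a : Fin n → ℤ) (σ : Finset (Fin n)) : Fin n → ℤ :=
  fun i => if i ∈ σ then (ρ i : ℤ) else a i

/-- after renaming the variables, `G(I) = {X_{m+1}^{ρ_{m+1}}, …, X_n^{ρ_n}} ∪ G_0(I)`: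
the generators involving exactly one variable are precisely the pure powers `X_j^{ρ_j}`
for the variables `j` with `m ≤ j` (0-based indexing), and every other generator
involves at least two variables; the Stanley–Reisner complex `Δ` of `√I` then lies on
the vertex set `[m] = {j : j < m}` -/
def SplitAt {n : ℕ} (G : Finset (Expo n)) (m : ℕ) : Prop :=
  m ≤ n ∧ (∀ j : Fin n, m ≤ (j : ℕ) → Finsupp.single j (rho G j) ∈ G) ∧
    ∀ u ∈ G, 2 ≤ u.support.card ∨ ∃ j : Fin n, m ≤ (j : ℕ) ∧ u = Finsupp.single j (rho G j)

/-- `a(σ)` is maximal with the properties `0 ≤ a ≤ ρ - 1` and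
`L(a(σ), u) ≠ ∅` for all `u ∈ G_0(I)` (for the fixed `σ`) -/
def MaximalA {n : ℕ} (G : Finset (Expo n)) (σ : Finset (Fin n)) (a : Fin n → ℤ) : Prop :=
  ∀ b : Fin n → ℤ, (∀ j, 0 ≤ b j) → (∀ j, b j ≤ (rho G j : ℤ) - 1) →
    (∀ u ∈ G0 G, (Lset (asub (rho G) b σ) u).Nonempty) →
    (∀ j, asub (rho G) a σ j ≤ asub (rho G) b σ j) →
    asub (rho G) a σ = asub (rho G) b σ

section
open CategoryTheory Opposite

universe u
variable {R : Type u} [CommRing R]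

/-- the contravariant Hom functor into `Y`, whose left derived functors define `Ext` -/
noncomputable abbrev homInto (Y : ModuleCat.{u} R) : ModuleCat.{u} R ⥤ (ModuleCat.{u} R)ᵒᵖ :=
  ((linearYoneda R (ModuleCat.{u} R)).obj Y).rightOp

/-- an element of `Hom(Z, Y)`, seen as a morphism to the dual of the free module of rank one -/
noncomputable def homElt {Z Y : ModuleCat.{u} R} (f : Z ⟶ Y) :
    (homInto Y).obj Z ⟶ op (ModuleCat.of R R) :=
  Quiver.Hom.op (ModuleCat.ofHom (LinearMap.toSpanSingleton R (Z ⟶ Y) f))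

lemma map_homElt {Z Z' Y : ModuleCat.{u} R} (g : Z' ⟶ Z) (f : Z ⟶ Y) :
    (homInto Y).map g ≫ homElt f = homElt (g ≫ f) := by
  apply Quiver.Hom.unop_inj
  refine ModuleCat.hom_ext (LinearMap.ext_ring ?_)
  change g ≫ ((1 : R) • f) = (1 : R) • (g ≫ f)
  rw [one_smul, one_smul]

lemma homElt_zero {Z Y : ModuleCat.{u} R} : homElt (0 : Z ⟶ Y) = 0 := by
  apply Quiver.Hom.unop_inj
  refine ModuleCat.hom_ext (LinearMap.ext_ring ?_)
  change (1 : R) • (0 : Z ⟶ Y) = 0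
  rw [one_smul]

lemma homElt_smul {Z Y : ModuleCat.{u} R} (r : R) (f : Z ⟶ Y) :
    homElt (r • f) = homElt f ≫ Quiver.Hom.op (ModuleCat.ofHom (r • LinearMap.id)) := by
  apply Quiver.Hom.unop_inj
  refine ModuleCat.hom_ext (LinearMap.ext_ring ?_)
  change (1 : R) • (r • f) = (r • (1 : R)) • f
  rw [one_smul, smul_eq_mul, mul_one]

lemma homElt_surjective {Z Y : ModuleCat.{u} R} (h : (homInto Y).obj Z ⟶ op (ModuleCat.of R R)) :
    ∃ f : Z ⟶ Y, homElt f = h := by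
  refine ⟨h.unop.hom (1 : R), ?_⟩
  apply Quiver.Hom.unop_inj
  refine ModuleCat.hom_ext (LinearMap.ext_ring ?_)
  exact one_smul R (h.unop.hom (1 : R) : Z ⟶ Y)

lemma homElt_injective {Z Y : ModuleCat.{u} R} {f g : Z ⟶ Y} (h : homElt f = homElt g) :
    f = g := by
  have : (1 : R) • f = (1 : R) • g := congrArg (fun k => k.unop.hom (1 : R)) h
  rwa [one_smul, one_smul] at this

section
variable {D : Type*} [Category* D] [Abelian D] {K L : ChainComplex D ℕ} {n : ℕ} {A : D}

/-- the morphism out of homology induced by a morphism which vanishes on boundaries -/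
noncomputable def homologyDesc (k : K.X n ⟶ A) (hk : K.d (n + 1) n ≫ k = 0) :
    K.homology n ⟶ A :=
  K.homologyι n ≫ K.descOpcycles k (n + 1) (by simp) hk

lemma homologyDesc_comp (k : K.X n ⟶ A) (hk : K.d (n + 1) n ≫ k = 0) {A' : D} (α : A ⟶ A') :
    homologyDesc k hk ≫ α =
      homologyDesc (k ≫ α) (by rw [← Category.assoc, hk, Limits.zero_comp]) := by
  simp [homologyDesc, HomologicalComplex.descOpcycles_comp]

lemma homologyMap_homologyDesc (φ : K ⟶ L) (k : L.X n ⟶ A) (hk : L.d (n + 1) n ≫ k = 0) :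
    HomologicalComplex.homologyMap φ n ≫ homologyDesc k hk =
      homologyDesc (φ.f n ≫ k) (by rw [← φ.comm_assoc, hk, Limits.comp_zero]) := by
  rw [homologyDesc, HomologicalComplex.homologyι_naturality_assoc,
    HomologicalComplex.opcyclesMap_comp_descOpcycles]
  rfl

lemma homologyDesc_eq_zero_iff [Injective A] (k : K.X (n + 1) ⟶ A)
    (hk : K.d (n + 1 + 1) (n + 1) ≫ k = 0) :
    homologyDesc k hk = 0 ↔ ∃ g : K.X n ⟶ A, K.d (n + 1) n ≫ g = k := by
  constructor
  · intro h
    have hex : (ShortComplex.mk _ _ (K.homologyι_comp_fromOpcycles (n + 1) n)).Exact :=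
      ShortComplex.exact_of_f_is_kernel _ (K.homologyIsKernel (n + 1) n (by simp))
    refine ⟨hex.descToInjective _ h, ?_⟩
    have := hex.comp_descToInjective _ h
    dsimp only at this
    rw [← K.p_fromOpcycles, Category.assoc, this, K.p_descOpcycles]
  · rintro ⟨g, rfl⟩
    exact K.homologyι_descOpcycles_eq_zero_of_boundary _ _ _ g rfl

end

section
variable {C D : Type*} [Category* C] [Category* D] [Abelian C] [Abelian D] [EnoughProjectives C]
  (F : C ⥤ D) [F.Additive] {X X' : C} (P : ProjectiveResolution X) {n : ℕ} {A A' : D}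

/-- the morphism out of a derived functor induced by a morphism which vanishes on boundaries -/
noncomputable def leftDerivedDesc (k : F.obj (P.complex.X n) ⟶ A)
    (hk : F.map (P.complex.d (n + 1) n) ≫ k = 0) : (F.leftDerived n).obj X ⟶ A :=
  (P.isoLeftDerivedObj F n).hom ≫
    homologyDesc (K := (F.mapHomologicalComplex _).obj P.complex) k hk

lemma leftDerivedDesc_comp (k : F.obj (P.complex.X n) ⟶ A)
    (hk : F.map (P.complex.d (n + 1) n) ≫ k = 0) (α : A ⟶ A') :
    leftDerivedDesc F P k hk ≫ α =
      leftDerivedDesc F P (k ≫ α) (by rw [← Category.assoc, hk, Limits.zero_comp]) :=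
  (Category.assoc _ _ _).trans (congrArg (fun q => (P.isoLeftDerivedObj F n).hom ≫ q)
    (homologyDesc_comp (K := (F.mapHomologicalComplex _).obj P.complex) k hk α))

lemma map_leftDerivedDesc {g : X' ⟶ X} {P' : ProjectiveResolution X'}
    (φ : ProjectiveResolution.Hom P' P g) (k : F.obj (P.complex.X n) ⟶ A)
    (hk : F.map (P.complex.d (n + 1) n) ≫ k = 0) :
    (F.leftDerived n).map g ≫ leftDerivedDesc F P k hk =
      leftDerivedDesc F P' (F.map (φ.hom.f n) ≫ k) (by
        rw [← Category.assoc, ← F.map_comp, ← φ.hom.comm, F.map_comp, Category.assoc, hk,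
          Limits.comp_zero]) :=
  (ProjectiveResolution.isoLeftDerivedObj_hom_naturality_assoc g P' P φ.hom
    (by simpa using φ.hom_f_zero_comp_π_f_zero) F n _).trans
    (congrArg (fun q => (P'.isoLeftDerivedObj F n).hom ≫ q)
      (homologyMap_homologyDesc (K := (F.mapHomologicalComplex _).obj P'.complex)
        (L := (F.mapHomologicalComplex _).obj P.complex)
        ((F.mapHomologicalComplex _).map φ.hom) k hk))

lemma leftDerivedDesc_eq_zero_iff [Injective A] (k : F.obj (P.complex.X (n + 1)) ⟶ A)
    (hk : F.map (P.complex.d (n + 1 + 1) (n + 1)) ≫ k = 0) :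
    leftDerivedDesc F P k hk = 0 ↔
      ∃ g : F.obj (P.complex.X n) ⟶ A, F.map (P.complex.d (n + 1) n) ≫ g = k :=
  Iff.trans ⟨fun h => (cancel_epi (P.isoLeftDerivedObj F (n + 1)).hom).1
      (h.trans Limits.comp_zero.symm),
    fun h => (congrArg (fun q => (P.isoLeftDerivedObj F (n + 1)).hom ≫ q) h).trans
      Limits.comp_zero⟩
    (homologyDesc_eq_zero_iff (K := (F.mapHomologicalComplex _).obj P.complex) k hk)
end

section
variable {X Y : ModuleCat.{u} R} (P : ProjectiveResolution X) {n : ℕ}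

lemma map_d_homElt (f : P.complex.X n ⟶ Y) (hf : P.complex.d (n + 1) n ≫ f = 0) :
    (homInto Y).map (P.complex.d (n + 1) n) ≫ homElt f = 0 := by
  rw [map_homElt, hf]
  exact homElt_zero

/-- the class in `Ext` of a cocycle on a projective resolution -/
noncomputable def extElt (f : P.complex.X n ⟶ Y) (hf : P.complex.d (n + 1) n ≫ f = 0) :
    ((_root_.Ext R (ModuleCat.{u} R) n).obj (op X)).obj Y :=
  (leftDerivedDesc (homInto Y) P (homElt f) (map_d_homElt P f hf)).unop.hom (1 : R)

lemma extElt_smul (r : R) (f : P.complex.X n ⟶ Y) (hf : P.complex.d (n + 1) n ≫ f = 0) :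
    extElt P (r • f) (by rw [Linear.comp_smul, hf, smul_zero]) = r • extElt P f hf := by
  have : leftDerivedDesc (homInto Y) P (homElt (r • f))
        (map_d_homElt P _ (by rw [Linear.comp_smul, hf, smul_zero])) =
      leftDerivedDesc (homInto Y) P (homElt f) (map_d_homElt P f hf) ≫
        Quiver.Hom.op (ModuleCat.ofHom (r • LinearMap.id)) := by
    rw [leftDerivedDesc_comp]
    congr 1
    exact homElt_smul r f
  rw [extElt, this]
  change (leftDerivedDesc (homInto Y) P (homElt f) (map_d_homElt P f hf)).unop.hom (r • (1 : R)) = _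
  rw [map_smul]
  rfl

lemma extElt_map {X' : ModuleCat.{u} R} {g : X' ⟶ X} {P' : ProjectiveResolution X'}
    (φ : ProjectiveResolution.Hom P' P g) (f : P.complex.X n ⟶ Y)
    (hf : P.complex.d (n + 1) n ≫ f = 0) :
    (((_root_.Ext R (ModuleCat.{u} R) n).map g.op).app Y).hom (extElt P f hf) =
      extElt P' (φ.hom.f n ≫ f) (by rw [← φ.hom.comm_assoc, hf, Limits.comp_zero]) := by
  have : ((homInto Y).leftDerived n).map g ≫
        leftDerivedDesc (homInto Y) P (homElt f) (map_d_homElt P f hf) =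
      leftDerivedDesc (homInto Y) P' (homElt (φ.hom.f n ≫ f)) (map_d_homElt P' _
        (by rw [← φ.hom.comm_assoc, hf, Limits.comp_zero])) := by
    rw [map_leftDerivedDesc _ _ φ]
    congr 1
  rw [extElt, extElt, ← this]
  rfl

lemma extElt_eq_zero_iff (f : P.complex.X (n + 1) ⟶ Y)
    (hf : P.complex.d (n + 1 + 1) (n + 1) ≫ f = 0) :
    extElt P f hf = 0 ↔ ∃ g : P.complex.X n ⟶ Y, P.complex.d (n + 1) n ≫ g = f := by
  have h1 : extElt P f hf = 0 ↔
      leftDerivedDesc (homInto Y) P (homElt f) (map_d_homElt P f hf) = 0 := by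
    constructor
    · intro h
      apply Quiver.Hom.unop_inj
      exact ModuleCat.hom_ext (LinearMap.ext_ring h)
    · intro h
      rw [extElt, h]
      rfl
  rw [h1, leftDerivedDesc_eq_zero_iff]
  constructor
  · rintro ⟨g, hg⟩
    obtain ⟨g, rfl⟩ := homElt_surjective g
    exact ⟨g, homElt_injective ((map_homElt _ _).symm.trans hg)⟩
  · rintro ⟨g, rfl⟩
    exact ⟨homElt g, map_homElt _ _⟩

end

section
open Abelian (Ext)

variable {X X' Y : ModuleCat.{u} R} {n : ℕ}

/-- the relation between a class in the Ext group defined through the derived category and a class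
in the derived functor of Hom, when they are represented by the same cocycle -/
def SameClass (α : Abelian.Ext X Y n)
    (z : ((_root_.Ext R (ModuleCat.{u} R) n).obj (op X)).obj Y) : Prop :=
  ∃ (f : (ProjectiveResolution.of X).complex.X n ⟶ Y)
    (hf : (ProjectiveResolution.of X).complex.d (n + 1) n ≫ f = 0),
    (ProjectiveResolution.of X).extMk f (n + 1) rfl hf = α ∧
      extElt (ProjectiveResolution.of X) f hf = z

lemma SameClass.exists (α : Abelian.Ext X Y n) :
    ∃ z : ((_root_.Ext R (ModuleCat.{u} R) n).obj (op X)).obj Y, SameClass α z := by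
  obtain ⟨f, hf, rfl⟩ := (ProjectiveResolution.of X).extMk_surjective α (n + 1) rfl
  exact ⟨_, f, hf, rfl, rfl⟩

lemma SameClass.eq_zero_iff {α : Abelian.Ext X Y (n + 1)}
    {z : ((_root_.Ext R (ModuleCat.{u} R) (n + 1)).obj (op X)).obj Y} (h : SameClass α z) :
    α = 0 ↔ z = 0 := by
  obtain ⟨f, hf, rfl, rfl⟩ := h
  rw [extElt_eq_zero_iff, ProjectiveResolution.extMk_eq_zero_iff _ _ _ _ _ n rfl]

lemma SameClass.precomp {α : Abelian.Ext X Y n}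
    {z : ((_root_.Ext R (ModuleCat.{u} R) n).obj (op X)).obj Y} (h : SameClass α z)
    (g : X' ⟶ X) :
    SameClass ((Ext.mk₀ g).comp α (zero_add n))
      ((((_root_.Ext R (ModuleCat.{u} R) n).map g.op).app Y).hom z) := by
  obtain ⟨f, hf, rfl, rfl⟩ := h
  let φ : ProjectiveResolution.Hom (ProjectiveResolution.of X') (ProjectiveResolution.of X) g :=
    ⟨ProjectiveResolution.lift g _ _, by
      simpa using ProjectiveResolution.lift_commutes_zero g _ _⟩
  exact ⟨φ.hom.f n ≫ f, by rw [← φ.hom.comm_assoc, hf, Limits.comp_zero],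
    (ProjectiveResolution.mk₀_comp_extMk f (n + 1) rfl hf φ).symm, (extElt_map _ φ f hf).symm⟩

lemma SameClass.smul {α : Abelian.Ext X Y n}
    {z : ((_root_.Ext R (ModuleCat.{u} R) n).obj (op X)).obj Y} (h : SameClass α z) (r : R) :
    SameClass (r • α) (r • z) := by
  obtain ⟨f, hf, rfl, rfl⟩ := h
  refine ⟨r • f, by rw [Linear.comp_smul, hf, smul_zero], ?_, extElt_smul _ r f hf⟩
  rw [Ext.smul_eq_comp_mk₀, ProjectiveResolution.extMk_comp_mk₀]
  simp

end
end

section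
open CategoryTheory Opposite

universe u
variable {R : Type u} [CommRing R]

/-- the cyclic module `R ⧸ J` -/
noncomputable abbrev cyc (J : Ideal R) : ModuleCat.{u} R := ModuleCat.of R (R ⧸ J)

/-- multiplication by `r`, as a map between cyclic modules -/
noncomputable def cycMul (r : R) {J J' : Ideal R} (h : ∀ z ∈ J, r * z ∈ J') : cyc J ⟶ cyc J' :=
  ModuleCat.ofHom (Submodule.mapQ J J' (r • LinearMap.id) fun z hz => by
    simpa using h z hz)

lemma cycMul_mk (r : R) {J J' : Ideal R} (h : ∀ z ∈ J, r * z ∈ J') (z : R) :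
    (cycMul r h).hom (Submodule.Quotient.mk z) = Submodule.Quotient.mk (r * z) :=
  rfl

lemma cyc_hom_ext {J : Ideal R} {M : ModuleCat.{u} R} {f g : cyc J ⟶ M}
    (h : f.hom (Submodule.Quotient.mk 1) = g.hom (Submodule.Quotient.mk 1)) : f = g := by
  refine ModuleCat.hom_ext (Submodule.linearMap_qext _ (LinearMap.ext_ring ?_))
  exact h

lemma cycMul_comp (r s : R) {J J' J'' : Ideal R} (h : ∀ z ∈ J, r * z ∈ J')
    (h' : ∀ z ∈ J', s * z ∈ J'') :
    cycMul r h ≫ cycMul s h' =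
      cycMul (s * r) (fun z hz => by rw [mul_assoc]; exact h' _ (h z hz)) := by
  apply cyc_hom_ext
  rw [ModuleCat.hom_comp, LinearMap.comp_apply, cycMul_mk, cycMul_mk, cycMul_mk, mul_assoc]

lemma cycMul_congr {r s : R} {J J' : Ideal R} (hrs : r = s) (h : ∀ z ∈ J, r * z ∈ J') :
    cycMul r h = cycMul s (hrs ▸ h) := by
  subst hrs
  rfl

lemma cycMul_self (r : R) (J : Ideal R) :
    cycMul r (fun z (hz : z ∈ J) => J.mul_mem_left r hz) = r • 𝟙 (cyc J) :=
  cyc_hom_ext rfl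

lemma cycMul_eq_smul (r : R) {J J' : Ideal R} (h : J ≤ J') :
    cycMul r (fun _ hz => J'.mul_mem_left r (h hz)) =
      r • cycMul 1 (fun z hz => by rw [one_mul]; exact h hz) := by
  apply cyc_hom_ext
  rw [ModuleCat.hom_smul, LinearMap.smul_apply, cycMul_mk, cycMul_mk]
  rw [one_mul]
  rfl

lemma cycMul_eq_zero (r : R) {J J' : Ideal R} (h : ∀ z ∈ J, r * z ∈ J') (hr : r ∈ J') :
    cycMul r h = 0 := by
  apply cyc_hom_ext
  rw [cycMul_mk, mul_one]
  exact (Submodule.Quotient.mk_eq_zero J').2 hr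

/-- the complex `R ⧸ J ⟶ R ⧸ J ⟶ R ⧸ (J + (r))` given by multiplication by `r` -/
noncomputable abbrev mulComplex (J : Ideal R) (r : R) : ShortComplex (ModuleCat.{u} R) :=
  ShortComplex.mk (cycMul r (fun z (hz : z ∈ J) => J.mul_mem_left r hz))
    (cycMul (J' := J ⊔ Ideal.span {r}) 1 (fun z hz => by
      rw [one_mul]; exact Ideal.mem_sup_left hz))
    (by
      rw [cycMul_comp]
      exact cycMul_eq_zero _ _
        (Ideal.mem_sup_right (by rw [one_mul]; exact Ideal.mem_span_singleton_self r)))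

lemma mulComplex_shortExact {J : Ideal R} {r : R} (h : ∀ z, r * z ∈ J → z ∈ J) :
    (mulComplex J r).ShortExact := by
  apply ModuleCat.shortComplex_shortExact
  · intro y
    constructor
    · intro hy
      obtain ⟨z, rfl⟩ := Submodule.Quotient.mk_surjective _ y
      have hz : z ∈ J ⊔ Ideal.span {r} := by
        rw [← one_mul z]
        exact (Submodule.Quotient.mk_eq_zero _).1 hy
      obtain ⟨a, ha, b, hb, rfl⟩ := Submodule.mem_sup.1 hz
      obtain ⟨c, rfl⟩ := Ideal.mem_span_singleton'.1 hb
      refine ⟨Submodule.Quotient.mk c, ?_⟩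
      refine (Submodule.Quotient.eq J).2 ?_
      have : r * c - (a + c * r) = -a := by ring
      change r * c - (a + c * r) ∈ J
      rw [this]
      exact J.neg_mem ha
    · rintro ⟨x, rfl⟩
      exact congrArg (fun k => k.hom x) (mulComplex J r).zero
  · change Function.Injective (cycMul r (fun z (hz : z ∈ J) => J.mul_mem_left r hz)).hom
    rw [injective_iff_map_eq_zero]
    intro y hy
    obtain ⟨z, rfl⟩ := Submodule.Quotient.mk_surjective _ y
    exact (Submodule.Quotient.mk_eq_zero J).2 (h z ((Submodule.Quotient.mk_eq_zero J).1 hy))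
  · intro y
    obtain ⟨z, rfl⟩ := Submodule.Quotient.mk_surjective _ y
    refine ⟨Submodule.Quotient.mk z, ?_⟩
    change Submodule.Quotient.mk (1 * z) = _
    rw [one_mul]

/-- the morphism of complexes induced by an inclusion of ideals and a factorization `s = q * r` -/
noncomputable abbrev mulComplexMap {J J' : Ideal R} (hJ : J ≤ J') {r s q : R} (hs : s = q * r) :
    mulComplex J s ⟶ mulComplex J' r where
  τ₁ := cycMul q (fun _ hz => J'.mul_mem_left q (hJ hz))
  τ₂ := cycMul 1 (fun z hz => by rw [one_mul]; exact hJ hz)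
  τ₃ := cycMul 1 (fun z hz => by
    rw [one_mul]
    refine sup_le_sup hJ ?_ hz
    rw [Ideal.span_singleton_le_span_singleton, hs]
    exact dvd_mul_left r q)
  comm₁₂ := by
    dsimp only
    rw [cycMul_comp, cycMul_comp]
    exact cycMul_congr (by rw [one_mul, hs, mul_comm]) _
  comm₂₃ := by
    dsimp only
    rw [cycMul_comp, cycMul_comp]

/-- the ideal generated by `b` and the `t`-th powers of the members of a list -/
def powIdeal (b : Ideal R) (t : ℕ) : List R → Ideal R
  | [] => b
  | x :: l => powIdeal b t l ⊔ Ideal.span {x ^ t}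

/-- the `t`-th powers of the members of a list form a regular sequence modulo `b`, starting from
the end of the list -/
def PowRegular (b : Ideal R) (t : ℕ) : List R → Prop
  | [] => True
  | x :: l => (∀ z, x ^ t * z ∈ powIdeal b t l → z ∈ powIdeal b t l) ∧ PowRegular b t l

lemma powIdeal_mono {b b' : Ideal R} (hb : b ≤ b') {s t : ℕ} (hst : t ≤ s) (l : List R) :
    powIdeal b s l ≤ powIdeal b' t l := by
  induction l with
  | nil => exact hb
  | cons x l ih =>
    refine sup_le_sup ih ?_
    rw [Ideal.span_singleton_le_span_singleton]
    exact pow_dvd_pow x hst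

/-- the iterated extension class of the Koszul sequences of the `t`-th powers of a list -/
noncomputable def koszulClass (b : Ideal R) (t : ℕ) : (l : List R) → PowRegular b t l →
    Abelian.Ext (cyc (powIdeal b t l)) (cyc b) l.length
  | [], _ => Abelian.Ext.mk₀ (𝟙 (cyc b))
  | _ :: l, h => (mulComplex_shortExact h.1).extClass.comp (koszulClass b t l h.2)
      (add_comm 1 l.length)

open Abelian

lemma ext_powIdeal_eq_zero (b : Ideal R) [Projective (cyc b)] (t : ℕ) (M : ModuleCat.{u} R)
    (l : List R) (h : PowRegular b t l) (j : ℕ) (hj : l.length < j)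
    (ξ : Ext (cyc (powIdeal b t l)) M j) : ξ = 0 := by
  induction l generalizing j with
  | nil =>
    obtain ⟨j, rfl⟩ := Nat.exists_eq_succ_of_ne_zero hj.ne'
    exact Ext.eq_zero_of_projective (P := cyc b) ξ
  | cons x l ih =>
    rw [List.length_cons] at hj
    obtain ⟨j, rfl⟩ := Nat.exists_eq_succ_of_ne_zero (Nat.ne_of_gt (Nat.zero_lt_of_lt hj))
    obtain ⟨η, rfl⟩ := Ext.contravariant_sequence_exact₃ (mulComplex_shortExact h.1) M ξ
      (ih h.2 (j + 1) (by lia) _) (add_comm 1 j)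
    exact (congrArg (fun q => (mulComplex_shortExact h.1).extClass.comp q (add_comm 1 j))
      (ih h.2 j (by lia) η)).trans (Ext.comp_zero _ _ _ _ _)

lemma exists_koszulClass_comp (b : Ideal R) [Projective (cyc b)] (t : ℕ) (M : ModuleCat.{u} R)
    (l : List R) (h : PowRegular b t l) (ξ : Ext (cyc (powIdeal b t l)) M l.length) :
    ∃ w : cyc b ⟶ M, (koszulClass b t l h).comp (Ext.mk₀ w) (add_zero _) = ξ := by
  induction l with
  | nil =>
    obtain ⟨w, rfl⟩ := (Ext.mk₀_bijective _ _).2 ξ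
    exact ⟨w, Ext.mk₀_id_comp _⟩
  | cons x l ih =>
    obtain ⟨η, rfl⟩ := Ext.contravariant_sequence_exact₃ (mulComplex_shortExact h.1) M ξ
      (ext_powIdeal_eq_zero b t M l h.2 (l.length + 1) (by lia) _) (add_comm 1 l.length)
    obtain ⟨w, rfl⟩ := ih h.2 η
    exact ⟨w, Ext.comp_assoc_of_third_deg_zero _ _ _ _⟩

lemma mem_of_koszulClass_comp_eq_zero (b : Ideal R) [Projective (cyc b)] (t : ℕ)
    (M : ModuleCat.{u} R) (l : List R) (h : PowRegular b t l) (w : cyc b ⟶ M)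
    (hw : (koszulClass b t l h).comp (Ext.mk₀ w) (add_zero _) = 0) :
    w.hom (Submodule.Quotient.mk 1) ∈ powIdeal b t l • (⊤ : Submodule R M) := by
  induction l generalizing w with
  | nil =>
    have : Ext.mk₀ w = 0 := (Ext.mk₀_id_comp _).symm.trans hw
    rw [Ext.mk₀_eq_zero_iff] at this
    rw [this]
    exact Submodule.zero_mem _
  | cons x l ih =>
    obtain ⟨η, hη⟩ := Ext.contravariant_sequence_exact₁ (mulComplex_shortExact h.1) M
      ((koszulClass b t l h.2).comp (Ext.mk₀ w) (add_zero _)) (add_comm 1 l.length)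
      ((Ext.comp_assoc_of_third_deg_zero _ _ _ _).symm.trans hw)
    obtain ⟨v, rfl⟩ := exists_koszulClass_comp b t M l h.2 η
    have hη : (Ext.mk₀ (cycMul (x ^ t) (fun z hz => (powIdeal b t l).mul_mem_left (x ^ t) hz))).comp
        ((koszulClass b t l h.2).comp (Ext.mk₀ v) (add_zero _)) (zero_add _) =
          (koszulClass b t l h.2).comp (Ext.mk₀ w) (add_zero _) := hη
    rw [cycMul_self, Ext.mk₀_smul, Ext.smul_comp, Ext.mk₀_id_comp] at hη
    have key : (koszulClass b t l h.2).comp (Ext.mk₀ (w - x ^ t • v)) (add_zero _) = 0 := by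
      rw [sub_eq_add_neg, Ext.mk₀_add, Ext.mk₀_neg, Ext.mk₀_smul, Ext.comp_add, Ext.comp_neg,
        Ext.comp_smul, ← hη, add_neg_cancel]
    have h1 := ih h.2 _ key
    rw [ModuleCat.hom_sub, ModuleCat.hom_smul, LinearMap.sub_apply, LinearMap.smul_apply] at h1
    have h2 : x ^ t • v.hom (Submodule.Quotient.mk 1) ∈
        powIdeal b t (x :: l) • (⊤ : Submodule R M) :=
      Submodule.smul_mem_smul (Ideal.mem_sup_right (Ideal.mem_span_singleton_self _))
        Submodule.mem_top
    rw [← sub_add_cancel (w.hom (Submodule.Quotient.mk 1)) (x ^ t • v.hom (Submodule.Quotient.mk 1))]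
    exact Submodule.add_mem _ (Submodule.smul_mono_left le_sup_left h1) h2

lemma koszulClass_naturality {b b' : Ideal R} (hb : b ≤ b') {s t : ℕ} (hst : t ≤ s) (l : List R)
    (h : PowRegular b s l) (h' : PowRegular b' t l) :
    (Ext.mk₀ (cycMul 1 (fun z hz => by rw [one_mul]; exact powIdeal_mono hb hst l hz))).comp
        (koszulClass b' t l h') (zero_add _) =
      (koszulClass b s l h).comp
        (Ext.mk₀ (cycMul (l.prod ^ (s - t)) (fun _ hz => b'.mul_mem_left _ (hb hz))))
        (add_zero _) := by
  induction l with
  | nil =>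
    refine (Ext.comp_mk₀_id _).trans (Eq.trans ?_ (Ext.mk₀_id_comp _).symm)
    exact congrArg Ext.mk₀ (cycMul_congr (by simp) _)
  | cons x l ih =>
    have hs : x ^ s = x ^ (s - t) * x ^ t := by rw [← pow_add, Nat.sub_add_cancel hst]
    have hnat := ShortComplex.ShortExact.extClass_naturality (mulComplex_shortExact h.1)
      (mulComplex_shortExact h'.1) (mulComplexMap (powIdeal_mono hb hst l) hs)
    have hτ : (Ext.mk₀ (cycMul (x ^ (s - t)) (fun z hz => (powIdeal b' t l).mul_mem_left _
          (powIdeal_mono hb hst l hz)))).comp (koszulClass b' t l h'.2) (zero_add _) =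
        (koszulClass b s l h.2).comp (x ^ (s - t) • Ext.mk₀ (cycMul (l.prod ^ (s - t))
          (fun _ hz => b'.mul_mem_left _ (hb hz)))) (add_zero _) := by
      rw [cycMul_eq_smul (x ^ (s - t)) (powIdeal_mono hb hst l), Ext.mk₀_smul, Ext.smul_comp,
        ih h.2 h'.2, Ext.comp_smul]
    have hprod : cycMul ((x :: l).prod ^ (s - t)) (fun _ hz => b'.mul_mem_left _ (hb hz)) =
        x ^ (s - t) • cycMul (l.prod ^ (s - t)) (fun _ hz => b'.mul_mem_left _ (hb hz)) := by
      rw [cycMul_eq_smul _ hb, cycMul_eq_smul (l.prod ^ (s - t)) hb, smul_smul, List.prod_cons,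
        mul_pow]
    rw [hprod]
    refine ((Ext.comp_assoc _ _ _ (zero_add 1) (add_comm 1 l.length) (by simp; lia)).symm.trans
      (congrArg (fun q => q.comp (koszulClass b' t l h'.2) (add_comm 1 l.length))
        hnat.symm)).trans ?_
    refine (Ext.comp_assoc_of_second_deg_zero _ _ _ _).trans ?_
    refine (congrArg (fun q => (mulComplex_shortExact h.1).extClass.comp q (add_comm 1 l.length))
      hτ).trans ?_
    rw [Ext.mk₀_smul]
    exact (Ext.comp_assoc_of_third_deg_zero _ _ _ _).symm

end

section
open CategoryTheory Opposite Limits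

universe u
variable {R : Type u} [CommRing R]

lemma exists_pow_smul_eq_zero_of_isNoetherian {H : Type*} [AddCommGroup H] [Module R H]
    [IsNoetherian R H] (x : R) (z : ℕ → H) (hz : ∀ t, x ^ t • z t = 0) :
    ∃ k, ∀ t, x ^ k • z t = 0 := by
  let f : ℕ →o Submodule R H :=
    { toFun := fun t => Submodule.torsionBy R H (x ^ t)
      monotone' := fun s t hst => Submodule.torsionBy_le_torsionBy_of_dvd _ _ (pow_dvd_pow x hst) }
  obtain ⟨k, hk⟩ := monotone_stabilizes_iff_noetherian.2 ‹IsNoetherian R H› f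
  refine ⟨k, fun t => ?_⟩
  have ht : z t ∈ f (k + t) := by
    change x ^ (k + t) • z t = 0
    rw [pow_add, mul_smul, hz, smul_zero]
  rw [← hk _ (Nat.le_add_right k t)] at ht
  exact ht

/-- the class in local cohomology of an element of an Ext module -/
noncomputable def toLocalCohomology (J : Ideal R) (n N : ℕ) (M : ModuleCat.{u} R) :
    ((_root_.Ext R (ModuleCat.{u} R) n).obj (op (cyc (J ^ N)))).obj M ⟶
      (localCohomology J n).obj M :=
  have := localCohomology.hasColimitDiagram.{u, 0} (localCohomology.idealPowersDiagram J) n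
  (colimit.ι (localCohomology.diagram (localCohomology.idealPowersDiagram J) n) (op (op N))).app M

lemma exists_map_eq_zero_of_toLocalCohomology_eq_zero (J : Ideal R) (n N : ℕ) (M : ModuleCat.{u} R)
    (z : ((_root_.Ext R (ModuleCat.{u} R) n).obj (op (cyc (J ^ N)))).obj M)
    (hz : (toLocalCohomology J n N M).hom z = 0) :
    ∃ s, ∃ hs : N ≤ s, (((_root_.Ext R (ModuleCat.{u} R) n).map (cycMul (J := J ^ s) (J' := J ^ N) 1
      (fun y hy => by rw [one_mul]; exact Ideal.pow_le_pow_right hs hy)).op).app M).hom z = 0 := by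
  have := localCohomology.hasColimitDiagram.{u, 0} (localCohomology.idealPowersDiagram J) n
  have := preservesFilteredColimitsOfSize_shrink.{0, u, 0, u} (forget (ModuleCat.{u} R))
  let F := localCohomology.diagram (localCohomology.idealPowersDiagram J) n
  have hD := isColimitOfPreserves ((evaluation _ _).obj M) (colimit.isColimit F)
  obtain ⟨j, f, g, hfg⟩ := (Concrete.isColimit_rep_eq_iff_exists _ hD (i := op (op N))
    (j := op (op N)) z (0 : ((_root_.Ext R (ModuleCat.{u} R) n).obj (op (cyc (J ^ N)))).obj M)).1
    (hz.trans (map_zero (toLocalCohomology J n N M).hom).symm)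
  refine ⟨j.unop.unop, f.unop.unop.down.down, ?_⟩
  have h1 : (localCohomology.ringModIdeals (localCohomology.idealPowersDiagram J)).map f.unop =
      cycMul (J := J ^ j.unop.unop) (J' := J ^ N) 1
      (fun y hy => by rw [one_mul]; exact Ideal.pow_le_pow_right f.unop.unop.down.down hy) :=
    cyc_hom_ext (congrArg (fun y : R => (Submodule.Quotient.mk y : R ⧸ J ^ N)) (one_mul 1).symm)
  rw [← h1]
  exact hfg.trans (map_zero ((F.map g).app M).hom)

open Abelian in
lemma exists_pow_smul_ext_eq_zero (J : Ideal R) (n : ℕ) (M : ModuleCat.{u} R)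
    [IsNoetherian R ((localCohomology J (n + 1)).obj M)] (x : R) (N : ℕ → ℕ)
    (ξ : ∀ t, Ext (cyc (J ^ N t)) M (n + 1)) (hξ : ∀ t, x ^ t • ξ t = 0) :
    ∃ k, ∀ t, ∃ s, ∃ hs : N t ≤ s, x ^ k • (Ext.mk₀ (cycMul (J := J ^ s) (J' := J ^ N t) 1
      (fun y hy => by rw [one_mul]; exact Ideal.pow_le_pow_right hs hy))).comp (ξ t)
        (zero_add _) = 0 := by
  choose z hz using fun t => SameClass.exists (ξ t)
  obtain ⟨k, hk⟩ := exists_pow_smul_eq_zero_of_isNoetherian x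
    (fun t => (toLocalCohomology J (n + 1) (N t) M).hom (z t)) (fun t => by
      rw [← map_smul, (((hz t).smul (x ^ t)).eq_zero_iff).1 (hξ t), map_zero])
  refine ⟨k, fun t => ?_⟩
  obtain ⟨s, hs, h⟩ := exists_map_eq_zero_of_toLocalCohomology_eq_zero J (n + 1) (N t) M
    (x ^ k • z t) (by rw [map_smul]; exact hk t)
  refine ⟨s, hs, ?_⟩
  rw [← Ext.comp_smul]
  exact (((hz t).smul (x ^ k)).precomp _).eq_zero_iff.2 h

end

section
open CategoryTheory

universe u
variable {R : Type u} [CommRing R]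

instance projective_cyc_bot : Projective (cyc (⊥ : Ideal R)) := by
  have : Module.Projective R (R ⧸ (⊥ : Ideal R)) :=
    Module.Projective.of_equiv (Submodule.quotEquivOfEqBot (⊥ : Ideal R) rfl).symm
  exact (IsProjective.iff_projective _).1 this

lemma mk_mem_smul_top {I J : Ideal R} {z : R}
    (hz : (Submodule.Quotient.mk z : R ⧸ I) ∈ J • (⊤ : Submodule R (R ⧸ I))) : z ∈ J ⊔ I := by
  have h : J • (⊤ : Submodule R (R ⧸ I)) = Submodule.map (Submodule.mkQ I) J := by
    rw [← Submodule.range_mkQ I, LinearMap.range_eq_map, ← Submodule.map_smul'', smul_eq_mul,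
      Ideal.mul_top]
  rw [h] at hz
  obtain ⟨y, hy, hyz⟩ := hz
  have : z - y ∈ I := (Submodule.Quotient.eq I).1 hyz.symm
  rw [← add_sub_cancel y z]
  exact Submodule.add_mem_sup hy this

lemma pow_mem_powIdeal (b : Ideal R) (t : ℕ) (x : R) (l : List R) :
    x ^ t ∈ powIdeal b t (x :: l) :=
  Ideal.mem_sup_right (Ideal.mem_span_singleton_self _)

lemma powIdeal_bot_le {J : Ideal R} {t s : ℕ} (hts : t ≤ s) (l : List R) (hl : ∀ x ∈ l, x ∈ J) :
    powIdeal ⊥ s l ≤ J ^ t := by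
  induction l with
  | nil => exact bot_le
  | cons x l ih =>
    refine sup_le (ih fun y hy => hl y (List.mem_cons_of_mem _ hy)) ?_
    rw [Ideal.span_singleton_le_iff_mem]
    exact Ideal.pow_le_pow_right hts (Ideal.pow_mem_pow (hl x List.mem_cons_self) s)

lemma le_powIdeal (b : Ideal R) (t : ℕ) (l : List R) : b ≤ powIdeal b t l := by
  induction l with
  | nil => exact le_rfl
  | cons x l ih => exact ih.trans le_sup_left

open Abelian in
/-- If a local cohomology module of `R ⧸ I` is noetherian, then the classes of `w` along the powers
of a regular sequence cannot all survive. -/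
theorem exists_pow_mul_mem_powIdeal (J I P : Ideal R) (x : R) (l : List R)
    [IsNoetherian R ((localCohomology J (l.length + 1)).obj (cyc I))]
    (w : R) (hw : ∀ z ∈ P, w * z ∈ I) (hlJ : ∀ y ∈ x :: l, y ∈ J)
    (hJ : ∀ t, ∃ N, J ^ N ≤ powIdeal P t (x :: l)) (hP : ∀ t, PowRegular P t (x :: l))
    (h0 : ∀ t, PowRegular ⊥ t (x :: l)) :
    ∃ k, ∀ t, ∃ s, t ≤ s ∧ x ^ k * (w * (x :: l).prod ^ (s - t)) ∈ powIdeal I s (x :: l) := by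
  choose N hN using hJ
  let ξ : ∀ t, Ext (cyc (J ^ N t)) (cyc I) (l.length + 1) := fun t =>
    (Ext.mk₀ (cycMul 1 (fun z hz => by rw [one_mul]; exact hN t hz))).comp
      ((koszulClass P t (x :: l) (hP t)).comp (Ext.mk₀ (cycMul w hw)) (add_zero _)) (zero_add _)
  obtain ⟨k, hk⟩ := exists_pow_smul_ext_eq_zero J l.length (cyc I) x N ξ (fun t => by
    rw [← Ext.smul_comp, ← Ext.mk₀_smul, ← cycMul_eq_smul _ (hN t),
      cycMul_eq_zero _ _ (pow_mem_powIdeal P t x l), Ext.mk₀_zero, Ext.zero_comp])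
  refine ⟨k, fun t => ?_⟩
  obtain ⟨s, hs, h⟩ := hk t
  refine ⟨s + t, Nat.le_add_left t s, ?_⟩
  have hle := powIdeal_bot_le (Nat.le_add_right s t) (x :: l) hlJ
  have h1 := congrArg (fun q => (Ext.mk₀ (cycMul (J := powIdeal ⊥ (s + t) (x :: l)) (J' := J ^ s) 1
    (fun z hz => by rw [one_mul]; exact hle hz))).comp q (zero_add _)) h
  dsimp only [ξ] at h1
  rw [Ext.comp_smul, Ext.comp_zero, Ext.mk₀_comp_mk₀_assoc, Ext.mk₀_comp_mk₀_assoc, cycMul_comp,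
    cycMul_comp, cycMul_congr (show (1 : R) * (1 * 1) = 1 by simp),
    ← Ext.comp_assoc_of_third_deg_zero,
    koszulClass_naturality (bot_le : ⊥ ≤ P) (Nat.le_add_left t s) (x :: l) (h0 _) (hP t),
    Ext.comp_assoc_of_third_deg_zero, Ext.mk₀_comp_mk₀, cycMul_comp, ← Ext.comp_smul,
    ← Ext.mk₀_smul] at h1
  have h2 := mem_of_koszulClass_comp_eq_zero ⊥ (s + t) (cyc I) (x :: l) (h0 _) _ h1
  rw [ModuleCat.hom_smul, LinearMap.smul_apply, cycMul_mk, mul_one] at h2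
  exact (sup_le (powIdeal_mono bot_le le_rfl (x :: l)) (le_powIdeal I (s + t) (x :: l)) :
    powIdeal ⊥ (s + t) (x :: l) ⊔ I ≤ _) (mk_mem_smul_top h2)

end

section
variable {K} {n : ℕ}

lemma mem_span_monomial {E : Set (Expo n)} {d : Expo n}
    (h : monomial d (1 : K) ∈ Ideal.span ((fun u => monomial u (1 : K)) '' E)) :
    ∃ u ∈ E, u ≤ d :=
  mem_ideal_span_monomial_image.1 h d (by
    rw [mem_support_iff, coeff_monomial, if_pos rfl]
    exact one_ne_zero)

lemma monomial_mem_span {E : Set (Expo n)} {u d : Expo n} (hu : u ∈ E) (hud : u ≤ d) :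
    monomial d (1 : K) ∈ Ideal.span ((fun u => monomial u (1 : K)) '' E) := by
  rw [mem_ideal_span_monomial_image]
  intro v hv
  rw [mem_singleton.1 (support_monomial_subset hv)]
  exact ⟨u, hu, hud⟩

lemma powIdeal_map_X (E : Set (Expo n)) (t : ℕ) (L : List (Fin n)) :
    powIdeal (Ideal.span ((fun u => monomial u (1 : K)) '' E)) t (L.map X) =
      Ideal.span ((fun u => monomial u (1 : K)) '' (E ∪ {u | ∃ j ∈ L, u = Finsupp.single j t})) := by
  induction L with
  | nil => simp [powIdeal]
  | cons j L ih =>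
    have : E ∪ {u | ∃ i ∈ j :: L, u = Finsupp.single i t} =
        E ∪ {u | ∃ i ∈ L, u = Finsupp.single i t} ∪ {Finsupp.single j t} := by
      ext u
      simp only [Set.mem_union, Set.mem_ofPred_eq, List.mem_cons, Set.mem_singleton_iff]
      grind
    rw [this, Set.image_union, Ideal.span_union, ← ih, Set.image_singleton, ← X_pow_eq_monomial]
    rfl

lemma mem_span_of_X_pow_mul_mem {E : Set (Expo n)} {j : Fin n} (hE : ∀ u ∈ E, u j = 0) (t : ℕ)
    (z : MvPolynomial (Fin n) K)
    (hz : X j ^ t * z ∈ Ideal.span ((fun u => monomial u (1 : K)) '' E)) :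
    z ∈ Ideal.span ((fun u => monomial u (1 : K)) '' E) := by
  rw [mem_ideal_span_monomial_image] at hz ⊢
  intro v hv
  obtain ⟨u, hu, huv⟩ := hz (Finsupp.single j t + v) (by
    rw [X_pow_eq_monomial, mem_support_iff, coeff_monomial_mul, one_mul]
    exact mem_support_iff.1 hv)
  refine ⟨u, hu, fun i => ?_⟩
  by_cases hi : i = j
  · subst hi
    rw [hE u hu]
    exact Nat.zero_le _
  · have := huv i
    rwa [Finsupp.add_apply, Finsupp.single_apply, if_neg (Ne.symm hi), zero_add] at this

lemma powRegular_map_X {E : Set (Expo n)} {L : List (Fin n)} (hE : ∀ u ∈ E, ∀ j ∈ L, u j = 0)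
    (hL : L.Nodup) (t : ℕ) :
    PowRegular (Ideal.span ((fun u => monomial u (1 : K)) '' E)) t (L.map X) := by
  induction L with
  | nil => exact trivial
  | cons j L ih =>
    rw [List.nodup_cons] at hL
    refine ⟨?_, ih (fun u hu i hi => hE u hu i (List.mem_cons_of_mem _ hi)) hL.2⟩
    rw [powIdeal_map_X]
    refine mem_span_of_X_pow_mul_mem ?_ t
    rintro u (hu | ⟨i, hi, rfl⟩)
    · exact hE u hu j List.mem_cons_self
    · exact Finsupp.single_eq_of_ne fun h => hL.1 (h ▸ hi)

lemma prod_map_X (L : List (Fin n)) :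
    (L.map (X : Fin n → MvPolynomial (Fin n) K)).prod =
      monomial (L.map fun j => Finsupp.single j 1).sum 1 := by
  induction L with
  | nil => rfl
  | cons j L ih =>
    rw [List.map_cons, List.prod_cons, ih, List.map_cons, List.sum_cons, X, monomial_mul, one_mul]

lemma sum_map_single_apply (L : List (Fin n)) (j : Fin n) :
    ((L.map fun j => Finsupp.single j 1).sum : Expo n) j = L.count j := by
  induction L with
  | nil => simp
  | cons i L ih =>
    rw [List.map_cons, List.sum_cons, Finsupp.add_apply, ih, List.count_cons, Finsupp.single_apply,
      add_comm]
    simp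

lemma exists_idealM_pow_le (σ : Finset (Fin n)) (t : ℕ) :
    ∃ N, idealM K n ^ N ≤
      powIdeal (Ideal.span ((fun u => monomial u (1 : K)) '' {u | ∃ j ∉ σ, u = Finsupp.single j 1}))
        t (σ.toList.map X) := by
  refine Ideal.exists_pow_le_of_le_radical_of_fg ?_ (IsNoetherian.noetherian _)
  rw [idealM, Ideal.span_le, powIdeal_map_X]
  rintro _ ⟨j, rfl⟩
  by_cases hj : j ∈ σ
  · refine ⟨t, ?_⟩
    rw [X_pow_eq_monomial]
    exact monomial_mem_span (Or.inr ⟨j, Finset.mem_toList.2 hj, rfl⟩) le_rfl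
  · exact Ideal.le_radical (monomial_mem_span (Or.inl ⟨j, hj, rfl⟩) le_rfl)

/-- If a monomial `X^c` is killed in `S / I` by all variables outside of `σ` and the local
cohomology of `S / I` in degree `|σ|` is noetherian, then `X^c` becomes zero after inverting the
variables of `σ`. -/
theorem exists_le_off_of_isNoetherian (G : Finset (Expo n)) (σ : Finset (Fin n)) (hσ : σ.Nonempty)
    [IsNoetherian (MvPolynomial (Fin n) K) (locCoh K (monIdeal K G) σ.card)] (c : Expo n)
    (hc : ∀ ℓ ∉ σ, ∃ u ∈ G, u ≤ c + Finsupp.single ℓ 1) :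
    ∃ u ∈ G, ∀ j ∉ σ, u j ≤ c j := by
  obtain ⟨j₀, hj₀⟩ := hσ
  have hnd := σ.nodup_toList
  have hM := exists_idealM_pow_le (K := K) σ
  have hlen := σ.length_toList
  have hmem := fun j => Finset.mem_toList (a := j) (s := σ)
  generalize σ.toList = L at *
  cases L with
  | nil => exact absurd ((hmem j₀).2 hj₀) (List.not_mem_nil)
  | cons x L =>
    have hnoeth : IsNoetherian (MvPolynomial (Fin n) K)
        ((localCohomology (idealM K n)
          ((L.map (X : Fin n → MvPolynomial (Fin n) K)).length + 1)).obj (cyc (monIdeal K G))) := by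
      rw [List.length_map, ← List.length_cons, hlen]
      assumption
    obtain ⟨k, hk⟩ := exists_pow_mul_mem_powIdeal (idealM K n) (monIdeal K G)
      (Ideal.span ((fun u => monomial u (1 : K)) '' {u | ∃ j ∉ σ, u = Finsupp.single j 1}))
      (X x) (L.map X) (monomial c 1) (by
        intro z hz
        have : Ideal.span ((fun u => monomial u (1 : K)) ''
            {u : Expo n | ∃ j ∉ σ, u = Finsupp.single j 1}) ≤
            Submodule.comap (LinearMap.mulLeft (MvPolynomial (Fin n) K) (monomial c 1))
              (monIdeal K G) := by
          rw [Ideal.span_le]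
          rintro _ ⟨_, ⟨j, hj, rfl⟩, rfl⟩
          obtain ⟨u, hu, huc⟩ := hc j hj
          change monomial c 1 * monomial _ 1 ∈ monIdeal K G
          rw [monomial_mul, one_mul]
          exact monomial_mem_span hu huc
        exact this hz) (by
        intro y hy
        obtain ⟨j, -, rfl⟩ := List.mem_map.1 (show y ∈ (x :: L).map X from hy)
        exact Ideal.subset_span ⟨j, rfl⟩) hM
      (powRegular_map_X (by
        rintro _ ⟨i, hi, rfl⟩ j hj
        exact Finsupp.single_eq_of_ne fun h => hi (h ▸ (hmem j).1 hj)) hnd)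
      (fun t => by
        have := powRegular_map_X (K := K) (E := ∅) (fun u hu => hu.elim) hnd t
        rwa [Set.image_empty, Ideal.span_empty] at this)
    obtain ⟨s, hs, h⟩ := hk (k + c.degree + 1)
    rw [← List.map_cons, prod_map_X, X_pow_eq_monomial, monomial_pow, monomial_mul, monomial_mul,
      one_pow, one_mul, one_mul, monIdeal, powIdeal_map_X] at h
    obtain ⟨u, hu | ⟨j, hj, rfl⟩, hle⟩ := mem_span_monomial h
    · refine ⟨u, hu, fun j hj => (hle j).trans ?_⟩
      rw [Finsupp.add_apply, Finsupp.add_apply, Finsupp.smul_apply, sum_map_single_apply,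
        List.count_eq_zero_of_not_mem (fun h => hj ((hmem j).1 h)), Finsupp.single_eq_of_ne
        (fun h : j = x => hj ((hmem j).1 (h ▸ List.mem_cons_self)))]
      simp
    · exfalso
      have h1 := hle j
      rw [Finsupp.add_apply, Finsupp.add_apply, Finsupp.smul_apply, sum_map_single_apply,
        List.count_eq_one_of_mem hnd hj, Finsupp.single_eq_same, smul_eq_mul, mul_one] at h1
      have h2 : Finsupp.single x k j ≤ k := by
        rw [Finsupp.single_apply]
        split_ifs <;> lia
      have h3 := Finsupp.le_degree j c
      lia

end

section
variable {n : ℕ}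

lemma le_rho {G : Finset (Expo n)} {u : Expo n} (hu : u ∈ G) (j : Fin n) : u j ≤ rho G j :=
  Finset.le_sup (f := fun u : Expo n => u j) hu

lemma mem_Lset {a : Fin n → ℤ} {u : Expo n} {j : Fin n} : j ∈ Lset a u ↔ a j < (u j : ℤ) := by
  simp [Lset]

lemma asub_of_mem {ρ : Fin n → ℕ} {a : Fin n → ℤ} {σ : Finset (Fin n)} {j : Fin n} (hj : j ∈ σ) :
    asub ρ a σ j = ρ j :=
  if_pos hj

lemma asub_of_notMem {ρ : Fin n → ℕ} {a : Fin n → ℤ} {σ : Finset (Fin n)} {j : Fin n}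
    (hj : j ∉ σ) : asub ρ a σ j = a j :=
  if_neg hj

/-- If `a(σ)` is maximal and `X_ℓ` does not kill the monomial with exponent `a(σ)` modulo the
generators, then `ℓ` satisfies the combinatorial condition. -/
lemma MaximalA.condition_of_forall_not_le {G : Finset (Expo n)} {σ : Finset (Fin n)}
    {a : Fin n → ℤ} (hmax : MaximalA G σ a) {m : ℕ} (hm : SplitAt G m) (ha0 : ∀ j, 0 ≤ a j)
    (haρ : ∀ j, a j ≤ (rho G j : ℤ) - 1) {c : Expo n} (hc : ∀ j, (c j : ℤ) = asub (rho G) a σ j)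
    {ℓ : Fin n} (hℓ : ℓ ∉ σ) (h : ∀ u ∈ G, ¬ u ≤ c + Finsupp.single ℓ 1) :
    (ℓ : ℕ) < m ∧ a ℓ = (rho G ℓ : ℤ) - 1 ∧
      ∀ u ∈ G0 G, (Lset (asub (rho G) a (insert ℓ σ)) u).Nonempty := by
  have hcℓ : (c ℓ : ℤ) = a ℓ := (hc ℓ).trans (asub_of_notMem hℓ)
  have key : ∀ u ∈ G, ∃ j ∉ σ, c j + Finsupp.single ℓ 1 j < u j := by
    intro u hu
    obtain ⟨j, hj⟩ := not_forall.1 (h u hu)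
    have hj : c j + Finsupp.single ℓ 1 j < u j := not_le.1 hj
    refine ⟨j, fun hjσ => ?_, hj⟩
    have h1 := hc j
    rw [asub_of_mem hjσ] at h1
    have h2 := le_rho hu j
    lia
  have haℓ : a ℓ = (rho G ℓ : ℤ) - 1 := by
    by_contra hne
    have hlt := lt_of_le_of_ne (haρ ℓ) hne
    have heq := congrFun (hmax (Function.update a ℓ (a ℓ + 1)) ?_ ?_ ?_ ?_) ℓ
    · rw [asub_of_notMem hℓ, asub_of_notMem hℓ, Function.update_self] at heq
      lia
    · intro j
      rcases eq_or_ne j ℓ with rfl | hj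
      · rw [Function.update_self]
        have := ha0 j
        lia
      · rw [Function.update_of_ne hj]
        exact ha0 j
    · intro j
      rcases eq_or_ne j ℓ with rfl | hj
      · rw [Function.update_self]
        lia
      · rw [Function.update_of_ne hj]
        exact haρ j
    · intro u hu
      obtain ⟨j, hjσ, hj⟩ := key u (Finset.mem_of_mem_filter u hu)
      have hcj := hc j
      rw [asub_of_notMem hjσ] at hcj
      refine ⟨j, mem_Lset.2 ?_⟩
      rw [asub_of_notMem hjσ]
      rcases eq_or_ne j ℓ with rfl | hjℓ
      · rw [Finsupp.single_eq_same] at hj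
        rw [Function.update_self]
        lia
      · rw [Function.update_of_ne hjℓ]
        lia
    · intro j
      by_cases hj : j ∈ σ
      · rw [asub_of_mem hj, asub_of_mem hj]
      · rw [asub_of_notMem hj, asub_of_notMem hj]
        rcases eq_or_ne j ℓ with rfl | hjℓ
        · rw [Function.update_self]
          lia
        · rw [Function.update_of_ne hjℓ]
  refine ⟨?_, haℓ, fun u hu => ?_⟩
  · by_contra hmℓ
    refine h _ (hm.2.1 ℓ (not_lt.1 hmℓ)) (Finsupp.single_le_iff.2 ?_)
    rw [Finsupp.add_apply, Finsupp.single_eq_same]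
    lia
  · have huG := Finset.mem_of_mem_filter u hu
    obtain ⟨j, hjσ, hj⟩ := key u huG
    have hcj := hc j
    rw [asub_of_notMem hjσ] at hcj
    have hjℓ : j ≠ ℓ := by
      rintro rfl
      rw [Finsupp.single_eq_same] at hj
      have := le_rho huG j
      lia
    refine ⟨j, mem_Lset.2 ?_⟩
    rw [asub_of_notMem (fun h => (Finset.mem_insert.1 h).elim hjℓ hjσ)]
    lia

end

/-- **Theorem 2.1.** Let `I ⊆ S` be a monomial ideal and `i > 0`.
If `H^i_𝔪(S/I)` has finite length, then for every `(i-1)`-face `σ ∈ Δ` (i.e.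
`σ ∈ Δ` with `|σ| = i`) and every `a ∈ ℤⁿ` satisfying
(a) `0 ≤ a ≤ ρ - 1`, (b) `L(a(σ), u) ≠ ∅` for all `u ∈ G_0(I)`, and
(c) `a(σ)` maximal with properties (a) and (b) for the fixed `σ`,
there exists `ℓ ∈ [m] \ σ` such that (i) `a_ℓ = ρ_ℓ - 1` and (ii) for all
`u ∈ G_0(I)` with `ν_ℓ(u) = ρ_ℓ` one has `L(a(σ ∪ {ℓ}), u) ≠ ∅`. -/
theorem finite_length_implies_combinatorial_condition {n : ℕ} (G : Finset (Expo n))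
    (hG : MinGens G) (m : ℕ) (hm : SplitAt G m) (i : ℕ) (hi : 0 < i)
    (hFL : IsFiniteLength (MvPolynomial (Fin n) K) (locCoh K (monIdeal K G) i)) :
    ∀ σ ∈ (srComplex K G).faces, σ.card = i →
      ∀ a : Fin n → ℤ, (∀ j, 0 ≤ a j) → (∀ j, a j ≤ (rho G j : ℤ) - 1) →
        (∀ u ∈ G0 G, (Lset (asub (rho G) a σ) u).Nonempty) →
        MaximalA G σ a →
        ∃ ℓ : Fin n, (ℓ : ℕ) < m ∧ ℓ ∉ σ ∧ a ℓ = (rho G ℓ : ℤ) - 1 ∧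
          ∀ u ∈ G0 G, u ℓ = rho G ℓ →
            (Lset (asub (rho G) a (insert ℓ σ)) u).Nonempty := by
  intro σ hσ hcard a ha0 haρ hb hmax
  by_contra hno
  subst hcard
  have := (isFiniteLength_iff_isNoetherian_isArtinian.1 hFL).1
  let c : Expo n := Finsupp.equivFunOnFinite.symm fun j => (asub (rho G) a σ j).toNat
  have hc : ∀ j, (c j : ℤ) = asub (rho G) a σ j := fun j => by
    refine Int.toNat_of_nonneg ?_
    unfold asub
    split_ifs
    · exact Int.natCast_nonneg _
    · exact ha0 j
  obtain ⟨u, hu, huc⟩ := exists_le_off_of_isNoetherian (K := K) G σ (Finset.card_pos.1 hi) c (by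
    intro ℓ hℓ
    by_contra! hle
    obtain ⟨h1, h2, h3⟩ := hmax.condition_of_forall_not_le hm ha0 haρ hc hℓ hle
    exact hno ⟨ℓ, h1, hℓ, h2, fun u hu _ => h3 u hu⟩)
  rcases hm.2.2 u hu with h2 | ⟨j, -, rfl⟩
  · obtain ⟨j, hj⟩ := hb u (Finset.mem_filter.2 ⟨hu, h2⟩)
    rw [mem_Lset] at hj
    by_cases hjσ : j ∈ σ
    · rw [asub_of_mem hjσ] at hj
      have := le_rho hu j
      lia
    · have h1 := huc j hjσ
      have h2 := hc j
      lia
  · by_cases hjσ : j ∈ σ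
    · refine hσ (Ideal.mem_of_dvd _ (Finset.dvd_prod_of_mem _ hjσ) ⟨rho G j, ?_⟩)
      rw [X_pow_eq_monomial]
      exact Ideal.subset_span ⟨_, hu, rfl⟩
    · have h1 := huc j hjσ
      have h2 := hc j
      rw [asub_of_notMem hjσ] at h2
      rw [Finsupp.single_eq_same] at h1
      have := haρ j
      lia

end GH
end

section
/- Let I ⊂ S = K[X_1,…,X_n] be a monomial ideal and a ∈ Z^n with G_a = {j} for some j ∈ [m] and Δ_a ≠ ∅. Then the vertex set of Δ_a equals { ℓ ∈ [m] \ {j} : L(a({ℓ, j}), u) ≠ ∅ for all u ∈ G_0(I) }. -/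
/-!
Formalization of results from "Combinatorial characterizations of generalized
Cohen-Macaulay monomial ideals" (Y. Takayama).

Setting: `K` a field, `S = K[X_1, …, X_n]` realized as `MvPolynomial (Fin n) K`,
`I ⊆ S` a monomial ideal whose minimal monomial generators have the exponent
vectors in `G : Finset (Fin n →₀ ℕ)`.
-/

set_option maxHeartbeats 1000000
set_option synthInstance.maxHeartbeats 400000

open Finset MvPolynomial

namespace GH

variable (K : Type) [Field K]

/-- **Lemma 2.4.** Let `I ⊆ S` be a monomial ideal and `a ∈ ℤⁿ` with
`G_a = {j}` for some `j ∈ [m]` and `Δ_a ≠ ∅`. Then the vertex set of `Δ_a` equals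
`{ℓ ∈ [m] \ {j} : L(a({ℓ, j}), u) ≠ ∅ for all u ∈ G_0(I)}`. -/
theorem deltaA_vertex_set {n : ℕ} (G : Finset (Expo n)) (hG : MinGens G)
    (m : ℕ) (hm : SplitAt G m) (a : Fin n → ℤ) (j : Fin n) (hj : (j : ℕ) < m)
    (hGa : negSet a = {j}) (hne : (deltaA G a).faces.Nonempty) :
    ∀ ℓ : Fin n, {ℓ} ∈ (deltaA G a).faces ↔
      ((ℓ : ℕ) < m ∧ ℓ ≠ j ∧
        ∀ u ∈ G0 G, (Lset (asub (rho G) a {ℓ, j}) u).Nonempty) := by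
  have hneg : ∀ k, a k < 0 ↔ k = j := fun k => by
    have h : k ∈ negSet a ↔ k ∈ ({j} : Finset (Fin n)) := by rw [hGa]
    simpa [negSet] using h
  intro ℓ
  constructor
  · rintro ⟨hdisj, hhits⟩
    rw [hGa] at hdisj hhits
    refine ⟨?_, by simpa using hdisj, fun u hu => ?_⟩
    · by_contra! hℓ
      obtain ⟨k, hk, hk0, hku⟩ := hhits _ (hm.2.1 ℓ hℓ)
      have hkℓ : ℓ ≠ k := by rintro rfl; simp at hk
      rw [Finsupp.single_eq_of_ne' hkℓ] at hku
      exact absurd hku (by simpa using hk0)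
    · obtain ⟨k, hk, -, hku⟩ := hhits u (mem_of_mem_filter u hu)
      have hk' : k ∉ ({ℓ, j} : Finset (Fin n)) := by simpa using hk
      refine ⟨k, mem_filter.2 ⟨mem_univ k, ?_⟩⟩
      rwa [asub, if_neg hk']
  · rintro ⟨hℓ, hℓj, hL⟩
    refine ⟨by simpa [hGa] using hℓj, fun u hu => ?_⟩
    rw [hGa]
    rcases hm.2.2 u hu with hcard | ⟨i, hi, rfl⟩
    · obtain ⟨k, hk⟩ := hL u (mem_filter.2 ⟨hu, hcard⟩)
      replace hk := (mem_filter.1 hk).2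
      have hk' : k ∉ ({ℓ, j} : Finset (Fin n)) := by
        intro hmem
        rw [asub, if_pos hmem] at hk
        have hle : u k ≤ rho G k := le_sup (f := fun v : Expo n => v k) hu
        omega
      rw [asub, if_neg hk'] at hk
      have hkj : k ≠ j := by rintro rfl; simp at hk'
      exact ⟨k, by simpa using hk', not_lt.1 (mt (hneg k).1 hkj), hk⟩
    · obtain ⟨F, -, hF⟩ := hne
      obtain ⟨k, -, hk0, hku⟩ := hF _ hu
      have hik : i = k := by
        by_contra hik
        rw [Finsupp.single_eq_of_ne' hik] at hku
        exact absurd hku (by simpa using hk0)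
      subst hik
      have hiℓ : i ≠ ℓ := by rintro rfl; omega
      have hij : i ≠ j := by rintro rfl; omega
      exact ⟨i, by simp [hiℓ, hij], hk0, hku⟩

end GH
end
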